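/- Let 1 < p < q < ∞, n ≥ 1, γ < n(p-1) and (α+n)/q = (γ+n)/p. Define ℍ(f)(x) = |B(0,|x|)|^{-1}∫_{|y|<|x|} f(y) dy on ℝⁿ. Then for f ∈ L^p(ℝⁿ, |x|^γ), ‖ℍ(f)‖_{L^q(ℝⁿ,|x|^α)} ≤ C*_{pq} ‖f‖_{L^p(ℝⁿ,|x|^γ)}, where C*_{pq} = |S^{n-1}|^{1/q-1/p} n^{1/p-1/q} (n(p-1)/(n(p-1)-γ))^{1/p'+1/q} (p'/q)^{1/q} ((p/(q-p)) B(p/(q-p), pq/(q'(q-p))))^{1/q-1/p}, and this constant is sharp. -/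

import Mathlib

open MeasureTheory Set
open scoped ENNReal

/-- The Euler Beta function `B(z,w) = ∫₀¹ t^(z-1) (1-t)^(w-1) dt`. -/
noncomputable def betaFn (z w : ℝ) : ℝ :=
  ∫ t in Ioo (0 : ℝ) 1, t ^ (z - 1) * (1 - t) ^ (w - 1)

/-- Surface area `|S^{n-1}| = 2 π^{n/2} / Γ(n/2)` of the unit sphere. -/
noncomputable def omegaN (n : ℕ) : ℝ :=
  2 * Real.pi ^ ((n : ℝ) / 2) / Real.Gamma ((n : ℝ) / 2)

/-- The `n`-dimensional Hardy operator with spherical mean: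
`ℍ f x = |B(0,|x|)|⁻¹ ∫_{|y|<|x|} f(y) dy`. -/
noncomputable def nHardy (n : ℕ) (f : EuclideanSpace ℝ (Fin n) → ℝ≥0∞)
    (x : EuclideanSpace ℝ (Fin n)) : ℝ≥0∞ :=
  (volume (Metric.ball (0 : EuclideanSpace ℝ (Fin n)) ‖x‖))⁻¹ *
    ∫⁻ y in Metric.ball (0 : EuclideanSpace ℝ (Fin n)) ‖x‖, f y

section Helpers

open Filter Topology

/-- A strictly monotone continuous function on a compact interval has a continuous left inverse. -/
lemma exists_continuous_leftInverse_of_strictMonoOn {φ : ℝ → ℝ} {a b : ℝ} (hab : a ≤ b)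
    (hc : ContinuousOn φ (Icc a b)) (hm : StrictMonoOn φ (Icc a b)) :
    ∃ Z : ℝ → ℝ, Continuous Z ∧ ∀ x ∈ Icc a b, Z (φ x) = x := by
  have hφ : φ a ≤ φ b := hm.monotoneOn (left_mem_Icc.2 hab) (right_mem_Icc.2 hab) hab
  have hbij : BijOn φ (Icc a b) (Icc (φ a) (φ b)) :=
    ⟨fun x hx => ⟨hm.monotoneOn (left_mem_Icc.2 hab) hx hx.1,
      hm.monotoneOn hx (right_mem_Icc.2 hab) hx.2⟩, hm.injOn, intermediate_value_Icc hab hc⟩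
  let e : Icc a b ≃ Icc (φ a) (φ b) := hbij.equiv
  have he : Continuous e :=
    (continuousOn_iff_continuous_domRestrict.1 hc).subtype_mk _
  refine ⟨fun u => ((he.homeoOfEquivCompactToT2).symm (projIcc (φ a) (φ b) hφ u) : ℝ),
    continuous_subtype_val.comp ((Homeomorph.continuous _).comp continuous_projIcc),
    fun x hx => ?_⟩
  have h1 : projIcc (φ a) (φ b) hφ (φ x) = he.homeoOfEquivCompactToT2 ⟨x, hx⟩ :=
    projIcc_of_mem hφ (hbij.mapsTo hx)
  simp only [h1, Homeomorph.symm_apply_apply]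

/-- If `h` dominates `s(y) y'` to the left of `t₀` and `y` vanishes at `-∞`, then the integral of
`h` dominates the primitive of `s` at `y t₀`. -/
lemma intervalIntegral_comp_le_integral_Iic {s y y' h : ℝ → ℝ} {t₀ : ℝ} (hs : Continuous s)
    (hy : ∀ t, HasDerivAt y (y' t) t) (hle : ∀ t ≤ t₀, s (y t) * y' t ≤ h t)
    (hh : Integrable h) (hlim : Tendsto y atBot (𝓝 0)) :
    ∫ u in (0 : ℝ)..y t₀, s u ≤ ∫ t in Iic t₀, h t := by
  let S : ℝ → ℝ := fun u => ∫ v in (0 : ℝ)..u, s v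
  have hS : ∀ u, HasDerivAt S (s u) u := fun u =>
    (hs.integral_hasStrictDerivAt 0 u).hasDerivAt
  have hSy : ∀ t, HasDerivAt (fun t => S (y t)) (s (y t) * y' t) t := fun t =>
    (hS (y t)).comp t (hy t)
  have hS0 : Tendsto (fun t => S (y t)) atBot (𝓝 0) := by
    have := ((hS 0).continuousAt.tendsto).comp hlim
    simpa [S, Function.comp_def] using this
  have h1 := intervalIntegral_tendsto_integral_Iic t₀ hh.integrableOn tendsto_id
  have h2 : Tendsto (fun t => S (y t₀) - S (y t)) atBot (𝓝 (S (y t₀) - 0)) :=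
    tendsto_const_nhds.sub hS0
  rw [sub_zero] at h2
  refine le_of_tendsto_of_tendsto h2 h1 ?_
  filter_upwards [eventually_le_atBot t₀] with A hA
  exact intervalIntegral.sub_le_integral_of_hasDeriv_right_of_le hA
    (fun t _ => (hSy t).continuousAt.continuousWithinAt)
    (fun t _ => (hSy t).hasDerivWithinAt) hh.integrableOn (fun t ht => hle t ht.2.le)

/-- The mirror image of `intervalIntegral_comp_le_integral_Iic`. -/
lemma neg_intervalIntegral_comp_le_integral_Ioi {s y y' h : ℝ → ℝ} {t₀ : ℝ} (hs : Continuous s)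
    (hy : ∀ t, HasDerivAt y (y' t) t) (hle : ∀ t, t₀ ≤ t → s (y t) * y' t ≤ h t)
    (hh : Integrable h) (hlim : Tendsto y atTop (𝓝 0)) :
    -∫ u in (0 : ℝ)..y t₀, s u ≤ ∫ t in Ioi t₀, h t := by
  have hy2 : ∀ t, HasDerivAt (fun t => y (-t)) (-y' (-t)) t := fun t => by
    simpa [Function.comp_def] using (hy (-t)).comp t (hasDerivAt_neg t)
  have h3 := intervalIntegral_comp_le_integral_Iic (s := fun u => -s u) (t₀ := -t₀)
    (h := fun t => h (-t)) hs.neg hy2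
    (fun t ht => by simpa using hle (-t) (by linarith)) hh.comp_neg
    (hlim.comp tendsto_neg_atBot_atTop)
  simpa [integral_comp_neg_Iic] using h3

/-- Young's inequality, in the form of a tangent bound for `z ↦ z ^ p`. -/
lemma rpow_tangent_le {p q z y ζ : ℝ} (hp : 1 < p) (hpq : p < q) (hz : 0 ≤ z) (hy : 0 ≤ y)
    (hζ : 0 ≤ ζ) (hζy : ζ ^ (p - 1) * (1 - ζ) = y ^ (q - p)) :
    p * (ζ * y) ^ (p - 1) * (z - (1 - 1 / p) * y) ≤ z ^ p - (p - 1) * y ^ q := by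
  have hp0 : 0 < p := by linarith
  have hw : 0 ≤ ζ * y := mul_nonneg hζ hy
  have hconj : p.HolderConjugate (p / (p - 1)) := Real.HolderConjugate.conjExponent hp
  have h1 := Real.young_inequality_of_nonneg hz (Real.rpow_nonneg hw (p - 1)) hconj
  rw [← Real.rpow_mul hw, mul_div_cancel₀ _ (by linarith : p - 1 ≠ 0)] at h1
  have h2 : (ζ * y) ^ p = (ζ * y) ^ (p - 1) * (ζ * y) := by
    conv_lhs => rw [show p = (p - 1) + 1 by ring]
    rw [Real.rpow_add_one' hw (by linarith)]
  have h3 : (ζ * y) ^ (p - 1) * (y * (1 - ζ)) = y ^ q := by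
    have e1 : y ^ p = y ^ (p - 1) * y := by
      conv_lhs => rw [show p = (p - 1) + 1 by ring]
      rw [Real.rpow_add_one' hy (by linarith)]
    have e2 : y ^ q = y ^ (q - p) * y ^ p := by
      rw [← Real.rpow_add' hy (by linarith)]; ring_nf
    rw [e2, ← hζy, e1, Real.mul_rpow hζ hy]; ring
  have h4 : p * (z * (ζ * y) ^ (p - 1)) ≤ z ^ p + (p - 1) * (ζ * y) ^ p := by
    have := mul_le_mul_of_nonneg_left h1 hp0.le
    refine this.trans_eq ?_
    field_simp
  rw [h2] at h4
  rw [← h3]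
  have h5 : p * (ζ * y) ^ (p - 1) * (z - (1 - 1 / p) * y) =
      p * (z * (ζ * y) ^ (p - 1)) - (p - 1) * ((ζ * y) ^ (p - 1) * y) := by
    field_simp
  rw [h5]
  nlinarith [h4]

/-- The equality case of `rpow_tangent_le`. -/
lemma rpow_tangent_eq {p q y ζ : ℝ} (hp : 1 < p) (hpq : p < q) (hy : 0 ≤ y)
    (hζ : 0 ≤ ζ) (hζy : ζ ^ (p - 1) * (1 - ζ) = y ^ (q - p)) :
    p * (ζ * y) ^ (p - 1) * (ζ * y - (1 - 1 / p) * y) = (ζ * y) ^ p - (p - 1) * y ^ q := by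
  have hp0 : 0 < p := by linarith
  have hw : 0 ≤ ζ * y := mul_nonneg hζ hy
  have h2 : (ζ * y) ^ p = (ζ * y) ^ (p - 1) * (ζ * y) := by
    conv_lhs => rw [show p = (p - 1) + 1 by ring]
    rw [Real.rpow_add_one' hw (by linarith)]
  have h3 : (ζ * y) ^ (p - 1) * (y * (1 - ζ)) = y ^ q := by
    have e1 : y ^ p = y ^ (p - 1) * y := by
      conv_lhs => rw [show p = (p - 1) + 1 by ring]
      rw [Real.rpow_add_one' hy (by linarith)]
    have e2 : y ^ q = y ^ (q - p) * y ^ p := by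
      rw [← Real.rpow_add' hy (by linarith)]; ring_nf
    rw [e2, ← hζy, e1, Real.mul_rpow hζ hy]; ring
  rw [h2, ← h3]
  field_simp
  ring

lemma strictMonoOn_rpow_mul_one_sub {p : ℝ} (hp : 1 < p) :
    StrictMonoOn (fun ζ : ℝ => ζ ^ (p - 1) * (1 - ζ)) (Icc 0 (1 - 1 / p)) := by
  have hc : Continuous (fun ζ : ℝ => ζ ^ (p - 1) * (1 - ζ)) :=
    (continuous_id.rpow_const fun _ => Or.inr (by linarith)).mul (by fun_prop)
  refine strictMonoOn_of_deriv_pos (convex_Icc _ _) hc.continuousOn fun x hx => ?_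
  rw [interior_Icc] at hx
  have hd : HasDerivAt (fun ζ : ℝ => ζ ^ (p - 1) * (1 - ζ))
      ((p - 1) * x ^ (p - 1 - 1) * (1 - x) + x ^ (p - 1) * (-1)) x := by
    refine (Real.hasDerivAt_rpow_const (Or.inl hx.1.ne')).mul ?_
    simpa using (hasDerivAt_id x).const_sub 1
  rw [hd.deriv]
  have e : x ^ (p - 1) = x ^ (p - 1 - 1) * x := by
    rw [← Real.rpow_add_one hx.1.ne']; ring_nf
  have h1 : 0 < x ^ (p - 1 - 1) := Real.rpow_pos_of_pos hx.1 _
  have h2 : p * x < p - 1 := by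
    have := mul_lt_mul_of_pos_left hx.2 (by linarith : 0 < p)
    rwa [mul_sub, mul_one, mul_one_div_cancel (by linarith)] at this
  rw [e]
  have : 0 < x ^ (p - 1 - 1) * (p - 1 - p * x) := mul_pos h1 (by linarith)
  nlinarith

lemma strictAntiOn_rpow_mul_one_sub {p : ℝ} (hp : 1 < p) :
    StrictAntiOn (fun ζ : ℝ => ζ ^ (p - 1) * (1 - ζ)) (Icc (1 - 1 / p) 1) := by
  have hc : Continuous (fun ζ : ℝ => ζ ^ (p - 1) * (1 - ζ)) :=
    (continuous_id.rpow_const fun _ => Or.inr (by linarith)).mul (by fun_prop)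
  refine strictAntiOn_of_deriv_neg (convex_Icc _ _) hc.continuousOn fun x hx => ?_
  rw [interior_Icc] at hx
  have ha : 0 < 1 - 1 / p := by
    have : 1 / p < 1 := by rw [div_lt_one (by linarith)]; exact hp
    linarith
  have hx0 : 0 < x := ha.trans hx.1
  have hd : HasDerivAt (fun ζ : ℝ => ζ ^ (p - 1) * (1 - ζ))
      ((p - 1) * x ^ (p - 1 - 1) * (1 - x) + x ^ (p - 1) * (-1)) x := by
    refine (Real.hasDerivAt_rpow_const (Or.inl hx0.ne')).mul ?_
    simpa using (hasDerivAt_id x).const_sub 1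
  rw [hd.deriv]
  have e : x ^ (p - 1) = x ^ (p - 1 - 1) * x := by
    rw [← Real.rpow_add_one hx0.ne']; ring_nf
  have h1 : 0 < x ^ (p - 1 - 1) := Real.rpow_pos_of_pos hx0 _
  have h2 : p - 1 < p * x := by
    have := mul_lt_mul_of_pos_left hx.1 (by linarith : 0 < p)
    rwa [mul_sub, mul_one, mul_one_div_cancel (by linarith)] at this
  rw [e]
  have : 0 < x ^ (p - 1 - 1) * (p * x - (p - 1)) := mul_pos h1 (by linarith)
  nlinarith

/-- The extremal profile in logarithmic coordinates. -/
noncomputable def bubble (p q t : ℝ) : ℝ :=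
  Real.exp (t / p) * (1 + Real.exp ((q / p - 1) * t)) ^ (-(1 / (q / p - 1)))

/-- The ratio between `bubble' + (1 - 1 / p) bubble` and `bubble`. -/
noncomputable def bubbleRatio (p q t : ℝ) : ℝ :=
  (1 + Real.exp ((q / p - 1) * t))⁻¹

lemma one_add_exp_pos (x : ℝ) : 0 < 1 + Real.exp x := by positivity

lemma bubble_pos (p q t : ℝ) : 0 < bubble p q t := by
  unfold bubble; positivity

lemma bubbleRatio_pos (p q t : ℝ) : 0 < bubbleRatio p q t := by
  unfold bubbleRatio; positivity

lemma bubbleRatio_le_one (p q t : ℝ) : bubbleRatio p q t ≤ 1 := by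
  unfold bubbleRatio
  exact inv_le_one_of_one_le₀ (by linarith [Real.exp_pos ((q / p - 1) * t)])

section Bubble

variable {p q : ℝ}

lemma div_sub_one_pos (hp : 1 < p) (hpq : p < q) : 0 < q / p - 1 := by
  have : 1 < q / p := by rw [lt_div_iff₀ (by linarith)]; linarith
  linarith

lemma hasDerivAt_bubble (hp : 1 < p) (hpq : p < q) (t : ℝ) :
    HasDerivAt (bubble p q)
      (bubbleRatio p q t * bubble p q t - (1 - 1 / p) * bubble p q t) t := by
  have hr := div_sub_one_pos hp hpq
  set r := q / p - 1 with hrdef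
  have h1 : HasDerivAt (fun t : ℝ => Real.exp (t / p)) (Real.exp (t / p) * (1 / p)) t :=
    ((hasDerivAt_id t).div_const p).exp
  have h2 : HasDerivAt (fun t : ℝ => 1 + Real.exp (r * t)) (Real.exp (r * t) * r) t := by
    simpa using (((hasDerivAt_id t).const_mul r).exp).const_add 1
  have h3 := h2.rpow_const (p := -(1 / r)) (Or.inl (one_add_exp_pos _).ne')
  have h4 := h1.mul h3
  unfold bubble bubbleRatio
  rw [← hrdef]
  refine h4.congr_deriv ?_
  have hE := one_add_exp_pos (r * t)
  have e : (1 + Real.exp (r * t)) ^ (-(1 / r) - 1) =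
      (1 + Real.exp (r * t)) ^ (-(1 / r)) * (1 + Real.exp (r * t))⁻¹ := by
    rw [Real.rpow_sub_one hE.ne']; rfl
  rw [e]
  field_simp
  ring

lemma continuous_bubble (hp : 1 < p) (hpq : p < q) : Continuous (bubble p q) :=
  continuous_iff_continuousAt.2 fun t => (hasDerivAt_bubble hp hpq t).continuousAt

lemma continuous_bubbleRatio : Continuous (bubbleRatio p q) := by
  unfold bubbleRatio
  exact Continuous.inv₀ (by fun_prop) fun t => (one_add_exp_pos _).ne'

lemma bubble_rpow (t k : ℝ) : bubble p q t ^ k =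
    Real.exp (k / p * t) * (1 + Real.exp ((q / p - 1) * t)) ^ (-(k / (q / p - 1))) := by
  have hE := one_add_exp_pos ((q / p - 1) * t)
  unfold bubble
  rw [Real.mul_rpow (Real.exp_pos _).le (by positivity), ← Real.rpow_mul hE.le, ← Real.exp_mul]
  ring_nf

lemma bubble_rpow_q (t : ℝ) : bubble p q t ^ q =
    Real.exp ((q / p) * t) * (1 + Real.exp ((q / p - 1) * t)) ^ (-(q / (q / p - 1))) :=
  bubble_rpow t q

lemma bubbleRatio_mul_bubble_rpow_p (hp : 1 < p) (hpq : p < q) (t : ℝ) :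
    (bubbleRatio p q t * bubble p q t) ^ p =
      Real.exp (1 * t) * (1 + Real.exp ((q / p - 1) * t)) ^ (-(q / (q / p - 1))) := by
  have hr := div_sub_one_pos hp hpq
  have hE := one_add_exp_pos ((q / p - 1) * t)
  rw [Real.mul_rpow (bubbleRatio_pos _ _ _).le (bubble_pos _ _ _).le, bubble_rpow]
  unfold bubbleRatio
  rw [← Real.rpow_neg_one, ← Real.rpow_mul hE.le, mul_left_comm, ← Real.rpow_add hE,
    div_self (by linarith : p ≠ 0)]
  congr 2
  have hqp : q - p ≠ 0 := by linarith
  have hp0 : p ≠ 0 := by linarith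
  have : q / p - 1 = (q - p) / p := by field_simp
  rw [this]
  field_simp
  ring

lemma bubbleRatio_rpow_mul (hp : 1 < p) (hpq : p < q) (t : ℝ) :
    bubbleRatio p q t ^ (p - 1) * (1 - bubbleRatio p q t) = bubble p q t ^ (q - p) := by
  have hr := div_sub_one_pos hp hpq
  have hE := one_add_exp_pos ((q / p - 1) * t)
  have hp0 : p ≠ 0 := by linarith
  have hqp : q - p ≠ 0 := by linarith
  have e0 : q / p - 1 = (q - p) / p := by field_simp
  rw [bubble_rpow]
  have e1 : (q - p) / p = q / p - 1 := e0.symm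
  have e2 : (q - p) / (q / p - 1) = p := by rw [e0]; field_simp
  have e3 : 1 - bubbleRatio p q t =
      Real.exp ((q / p - 1) * t) * bubbleRatio p q t := by
    unfold bubbleRatio; field_simp; ring
  have e4 : bubbleRatio p q t ^ (p - 1) * bubbleRatio p q t = bubbleRatio p q t ^ p := by
    rw [← Real.rpow_add_one (bubbleRatio_pos p q t).ne']; ring_nf
  rw [e2, e1, e3, mul_left_comm, e4]
  unfold bubbleRatio
  rw [Real.inv_rpow hE.le, Real.rpow_neg hE.le]

lemma integrable_exp_mul_one_add_exp_rpow {b r k : ℝ} (hb : 0 < b) (hk : 0 ≤ k)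
    (hbk : b < r * k) :
    Integrable fun t : ℝ => Real.exp (b * t) * (1 + Real.exp (r * t)) ^ (-k) := by
  have hcont : Continuous fun t : ℝ => Real.exp (b * t) * (1 + Real.exp (r * t)) ^ (-k) := by
    refine (by fun_prop : Continuous fun t : ℝ => Real.exp (b * t)).mul ?_
    exact Continuous.rpow_const (by fun_prop) fun t => Or.inl (one_add_exp_pos _).ne'
  rw [← integrableOn_univ, ← Iic_union_Ioi (a := (0 : ℝ))]
  refine IntegrableOn.union ?_ ?_
  · refine Integrable.mono' (integrableOn_exp_mul_Iic hb 0) hcont.aestronglyMeasurable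
      (Eventually.of_forall fun t => ?_)
    rw [Real.norm_of_nonneg (by positivity)]
    refine mul_le_of_le_one_right (Real.exp_pos _).le ?_
    exact Real.rpow_le_one_of_one_le_of_nonpos (by linarith [Real.exp_pos (r * t)]) (by linarith)
  · refine Integrable.mono' (integrableOn_exp_mul_Ioi (a := b - r * k) (by linarith) 0)
      hcont.aestronglyMeasurable (Eventually.of_forall fun t => ?_)
    rw [Real.norm_of_nonneg (by positivity)]
    have : (1 + Real.exp (r * t)) ^ (-k) ≤ Real.exp (r * t) ^ (-k) :=
      Real.rpow_le_rpow_of_nonpos (Real.exp_pos _) (by linarith) (by linarith)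
    refine (mul_le_mul_of_nonneg_left this (Real.exp_pos _).le).trans_eq ?_
    rw [← Real.exp_mul, ← Real.exp_add]
    ring_nf

lemma integrable_bubble_rpow_q (hp : 1 < p) (hpq : p < q) :
    Integrable fun t => bubble p q t ^ q := by
  have hr := div_sub_one_pos hp hpq
  simp_rw [bubble_rpow_q]
  refine integrable_exp_mul_one_add_exp_rpow (by linarith) (by apply div_nonneg <;> linarith) ?_
  rw [mul_div_cancel₀ _ hr.ne', div_lt_iff₀ (by linarith)]
  nlinarith

lemma integrable_bubbleRatio_mul_bubble_rpow_p (hp : 1 < p) (hpq : p < q) :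
    Integrable fun t => (bubbleRatio p q t * bubble p q t) ^ p := by
  have hr := div_sub_one_pos hp hpq
  simp_rw [bubbleRatio_mul_bubble_rpow_p hp hpq]
  refine integrable_exp_mul_one_add_exp_rpow one_pos (by apply div_nonneg <;> linarith) ?_
  rw [mul_div_cancel₀ _ hr.ne']; linarith

lemma tendsto_exp_mul_one_add_exp_rpow_atBot {b r k : ℝ} (hb : 0 < b) (hk : 0 ≤ k) :
    Tendsto (fun t : ℝ => Real.exp (b * t) * (1 + Real.exp (r * t)) ^ (-k)) atBot (𝓝 0) := by
  refine squeeze_zero (g := fun t => Real.exp (b * t)) (fun t => by positivity) (fun t => ?_) ?_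
  · refine mul_le_of_le_one_right (Real.exp_pos _).le ?_
    exact Real.rpow_le_one_of_one_le_of_nonpos (by linarith [Real.exp_pos (r * t)]) (by linarith)
  · exact Real.tendsto_exp_atBot.comp (tendsto_id.const_mul_atBot hb)

lemma tendsto_exp_mul_one_add_exp_rpow_atTop {b r k : ℝ} (hk : 0 ≤ k) (hbk : b < r * k) :
    Tendsto (fun t : ℝ => Real.exp (b * t) * (1 + Real.exp (r * t)) ^ (-k)) atTop (𝓝 0) := by
  refine squeeze_zero (g := fun t => Real.exp ((b - r * k) * t)) (fun t => by positivity)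
    (fun t => ?_) ?_
  · have : (1 + Real.exp (r * t)) ^ (-k) ≤ Real.exp (r * t) ^ (-k) :=
      Real.rpow_le_rpow_of_nonpos (Real.exp_pos _) (by linarith) (by linarith)
    refine (mul_le_mul_of_nonneg_left this (Real.exp_pos _).le).trans_eq ?_
    rw [← Real.exp_mul, ← Real.exp_add]
    ring_nf
  · exact Real.tendsto_exp_atBot.comp (tendsto_id.const_mul_atTop_of_neg (by linarith))

lemma bubble_eq (t : ℝ) : bubble p q t =
    Real.exp (1 / p * t) * (1 + Real.exp ((q / p - 1) * t)) ^ (-(1 / (q / p - 1))) := by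
  unfold bubble; ring_nf

lemma tendsto_bubble_atBot (hp : 1 < p) (hpq : p < q) : Tendsto (bubble p q) atBot (𝓝 0) := by
  have hr := div_sub_one_pos hp hpq
  rw [funext bubble_eq]
  exact tendsto_exp_mul_one_add_exp_rpow_atBot (by positivity) (by positivity)

lemma tendsto_bubble_atTop (hp : 1 < p) (hpq : p < q) : Tendsto (bubble p q) atTop (𝓝 0) := by
  have hr := div_sub_one_pos hp hpq
  rw [funext bubble_eq]
  refine tendsto_exp_mul_one_add_exp_rpow_atTop (by positivity) ?_
  rw [mul_one_div_cancel hr.ne', div_lt_one (by linarith)]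
  exact hp

/-- The first integral `(p - 1) (q / p) ∫ bubble ^ q` equals the `p`-energy of the bubble. -/
lemma integral_bubbleRatio_mul_bubble_rpow_p (hp : 1 < p) (hpq : p < q) :
    ∫ t, (bubbleRatio p q t * bubble p q t) ^ p =
      (p - 1) * (q / p) * ∫ t, bubble p q t ^ q := by
  have hr := div_sub_one_pos hp hpq
  have hp0 : p ≠ 0 := by linarith
  have hqp : q - p ≠ 0 := by linarith
  set r := q / p - 1 with hrdef
  have hk : 0 ≤ q / r - 1 := by
    have : q / p < q := by rw [div_lt_iff₀ (by linarith)]; nlinarith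
    have : 1 ≤ q / r := by rw [le_div_iff₀ hr]; linarith
    linarith
  have hd : ∀ t : ℝ, HasDerivAt (fun t : ℝ => Real.exp (1 * t) * (1 + Real.exp (r * t)) ^
      (-(q / r - 1)))
      ((bubbleRatio p q t * bubble p q t) ^ p - (p - 1) * (q / p) * bubble p q t ^ q) t := by
    intro t
    have hE := one_add_exp_pos (r * t)
    have h1 : HasDerivAt (fun t : ℝ => Real.exp (1 * t)) (Real.exp (1 * t)) t := by
      simpa using Real.hasDerivAt_exp t
    have h2 : HasDerivAt (fun t : ℝ => 1 + Real.exp (r * t)) (Real.exp (r * t) * r) t := by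
      simpa using (((hasDerivAt_id t).const_mul r).exp).const_add 1
    have h3 := h2.rpow_const (p := -(q / r - 1)) (Or.inl hE.ne')
    refine (h1.mul h3).congr_deriv ?_
    rw [bubbleRatio_mul_bubble_rpow_p hp hpq, bubble_rpow_q, ← hrdef]
    have e1 : (1 + Real.exp (r * t)) ^ (-(q / r - 1)) =
        (1 + Real.exp (r * t)) ^ (-(q / r)) * (1 + Real.exp (r * t)) := by
      rw [← Real.rpow_add_one hE.ne']; ring_nf
    have e2 : -(q / r - 1) - 1 = -(q / r) := by ring
    have e3 : Real.exp ((q / p) * t) = Real.exp (1 * t) * Real.exp (r * t) := by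
      rw [← Real.exp_add, hrdef]; ring_nf
    rw [e1, e2, e3]
    have e4 : r * (q / r - 1) = (p - 1) * (q / p) + 1 := by
      rw [mul_sub, mul_div_cancel₀ _ hr.ne', hrdef]; field_simp; ring
    have e5 : Real.exp (r * t) * r * -(q / r - 1) =
      -(Real.exp (r * t) * ((p - 1) * (q / p) + 1)) := by rw [← e4]; ring
    rw [e5]
    ring
  have hi := integral_of_hasDerivAt_of_tendsto hd
    ((integrable_bubbleRatio_mul_bubble_rpow_p hp hpq).sub
      ((integrable_bubble_rpow_q hp hpq).const_mul _))
    (tendsto_exp_mul_one_add_exp_rpow_atBot one_pos hk)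
    (tendsto_exp_mul_one_add_exp_rpow_atTop hk (by
      have : q / p < q := by rw [div_lt_iff₀ (by linarith)]; nlinarith
      rw [mul_sub, mul_div_cancel₀ _ hr.ne']; linarith))
  rw [integral_sub (integrable_bubbleRatio_mul_bubble_rpow_p hp hpq)
      ((integrable_bubble_rpow_q hp hpq).const_mul _), integral_const_mul] at hi
  linarith

lemma integral_bubble_rpow_q_pos (hp : 1 < p) (hpq : p < q) : 0 < ∫ t, bubble p q t ^ q := by
  rw [integral_pos_iff_support_of_nonneg (fun t => Real.rpow_nonneg (bubble_pos _ _ _).le _)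
    (integrable_bubble_rpow_q hp hpq)]
  have : Function.support (fun t => bubble p q t ^ q) = univ := by
    ext t; simp [(Real.rpow_pos_of_pos (bubble_pos p q t) q).ne']
  rw [this]; simp

end Bubble

section Comparison

variable {p q : ℝ}

lemma exists_bubbleRatio_eq (hp : 1 < p) (hpq : p < q) :
    ∃ τ, bubbleRatio p q τ = 1 - 1 / p := by
  have hr := div_sub_one_pos hp hpq
  refine ⟨Real.log (1 / (p - 1)) / (q / p - 1), ?_⟩
  unfold bubbleRatio
  rw [mul_div_cancel₀ _ hr.ne', Real.exp_log (by apply one_div_pos.2; linarith)]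
  have : p - 1 ≠ 0 := by linarith
  have : p ≠ 0 := by linarith
  field_simp
  rw [sub_add_cancel, div_self this]

lemma one_sub_one_div_mem (hp : 1 < p) : 1 - 1 / p ∈ Ioo (0 : ℝ) 1 := by
  have h1 : 1 / p < 1 := by rw [div_lt_one (by linarith)]; exact hp
  have h2 : 0 < 1 / p := by positivity
  constructor <;> linarith

lemma bubbleRatio_antitone (hp : 1 < p) (hpq : p < q) : Antitone (bubbleRatio p q) := by
  have hr := div_sub_one_pos hp hpq
  intro s t hst
  unfold bubbleRatio
  gcongr

/-- Among solutions of `y' + (1 - 1 / p) y = g` with the same maximal value, the bubble minimizes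
`∫ g ^ p - (p - 1) ∫ y ^ q`. -/
lemma integral_bubble_le_of_max_eq (hp : 1 < p) (hpq : p < q) {y g : ℝ → ℝ}
    (hder : ∀ t, HasDerivAt y (g t - (1 - 1 / p) * y t) t) (hg : ∀ t, 0 ≤ g t)
    (hy : ∀ t, 0 ≤ y t) (hbot : Tendsto y atBot (𝓝 0)) (htop : Tendsto y atTop (𝓝 0))
    (hgp : Integrable fun t => g t ^ p) (hyq : Integrable fun t => y t ^ q) {t₀ τ : ℝ}
    (hmax : ∀ t, y t ≤ y t₀) (hτ : bubbleRatio p q τ = 1 - 1 / p)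
    (hM : y t₀ = bubble p q τ) :
    (∫ t, (bubbleRatio p q t * bubble p q t) ^ p) - (p - 1) * ∫ t, bubble p q t ^ q ≤
      (∫ t, g t ^ p) - (p - 1) * ∫ t, y t ^ q := by
  have ha := one_sub_one_div_mem hp
  have hr := div_sub_one_pos hp hpq
  set a := 1 - 1 / p with hadef
  let φ : ℝ → ℝ := fun ζ => ζ ^ (p - 1) * (1 - ζ)
  have hφ : Continuous φ :=
    (continuous_id.rpow_const fun _ => Or.inr (by linarith)).mul (by fun_prop)
  have hφ0 : φ 0 = 0 := by simp [φ, Real.zero_rpow (by linarith : p - 1 ≠ 0)]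
  have hφ1 : φ 1 = 0 := by simp [φ]
  have hφa : φ a = y t₀ ^ (q - p) := by
    rw [hM, ← bubbleRatio_rpow_mul hp hpq, hτ]
  have hrange : ∀ u, 0 ≤ u → u ≤ y t₀ → u ^ (q - p) ∈ Icc 0 (φ a) := fun u h0 h1 =>
    ⟨Real.rpow_nonneg h0 _, hφa ▸ Real.rpow_le_rpow h0 h1 (by linarith)⟩
  let h : ℝ → ℝ := fun t => g t ^ p - (p - 1) * y t ^ q
  let hb : ℝ → ℝ := fun t =>
    (bubbleRatio p q t * bubble p q t) ^ p - (p - 1) * bubble p q t ^ q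
  have hhint : Integrable h := hgp.sub (hyq.const_mul _)
  have hhbint : Integrable hb := (integrable_bubbleRatio_mul_bubble_rpow_p hp hpq).sub
    ((integrable_bubble_rpow_q hp hpq).const_mul _)
  have hslope : ∀ Z : ℝ → ℝ, Continuous Z →
      Continuous fun u : ℝ => p * (Z (u ^ (q - p)) * u) ^ (p - 1) := fun Z hZ => by
    refine continuous_const.mul (Continuous.rpow_const ?_ fun _ => Or.inr (by linarith))
    exact (hZ.comp (continuous_id.rpow_const fun _ => Or.inr (by linarith))).mul continuous_id
  have hleft : ∫ t in Iic τ, hb t ≤ ∫ t in Iic t₀, h t := by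
    obtain ⟨Z, hZc, hZ⟩ := exists_continuous_leftInverse_of_strictMonoOn ha.2.le
      hφ.neg.continuousOn (strictAntiOn_rpow_mul_one_sub hp).neg
    have hZ' : ∀ u ∈ Icc 0 (φ a), 0 ≤ Z (-u) ∧ φ (Z (-u)) = u := fun u hu => by
      obtain ⟨x, hx, rfl⟩ := intermediate_value_Icc' ha.2.le hφ.continuousOn
        (by rwa [hφ1] : u ∈ Icc (φ 1) (φ a))
      have hx' : Z (-φ x) = x := hZ x hx
      rw [hx']
      exact ⟨ha.1.le.trans hx.1, rfl⟩
    have hsc := hslope (fun u => Z (-u)) (hZc.comp continuous_neg)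
    have h1 := intervalIntegral_comp_le_integral_Iic (t₀ := t₀) (h := h) hsc hder
      (fun t _ => by
        have := hZ' _ (hrange _ (hy t) (hmax t))
        exact rpow_tangent_le hp hpq (hg t) (hy t) this.1 this.2) hhint hbot
    have h2 := intervalIntegral_comp_le_integral_Iic (t₀ := τ) (h := fun t => -hb t)
      (s := fun u => -(p * (Z (-u ^ (q - p)) * u) ^ (p - 1))) hsc.neg
      (hasDerivAt_bubble hp hpq) (fun t ht => by
        have hmem : bubbleRatio p q t ∈ Icc a 1 :=
          ⟨hτ ▸ bubbleRatio_antitone hp hpq ht, bubbleRatio_le_one p q t⟩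
        have e : Z (-bubble p q t ^ (q - p)) = bubbleRatio p q t := by
          rw [← bubbleRatio_rpow_mul hp hpq]; exact hZ _ hmem
        have := rpow_tangent_eq hp hpq (bubble_pos p q t).le (bubbleRatio_pos p q t).le
          (bubbleRatio_rpow_mul hp hpq t)
        rw [e, neg_mul, this]) hhbint.neg (tendsto_bubble_atBot hp hpq)
    rw [intervalIntegral.integral_neg, integral_neg, ← hM] at h2
    linarith
  have hright : ∫ t in Ioi τ, hb t ≤ ∫ t in Ioi t₀, h t := by
    obtain ⟨Z, hZc, hZ⟩ := exists_continuous_leftInverse_of_strictMonoOn ha.1.le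
      hφ.continuousOn (strictMonoOn_rpow_mul_one_sub hp)
    have hZ' : ∀ u ∈ Icc 0 (φ a), 0 ≤ Z u ∧ φ (Z u) = u := fun u hu => by
      obtain ⟨x, hx, rfl⟩ := intermediate_value_Icc ha.1.le hφ.continuousOn
        (by rwa [hφ0] : u ∈ Icc (φ 0) (φ a))
      have hx' : Z (φ x) = x := hZ x hx
      rw [hx']
      exact ⟨hx.1, rfl⟩
    have hsc := hslope Z hZc
    have h1 := neg_intervalIntegral_comp_le_integral_Ioi (t₀ := t₀) (h := h) hsc hder
      (fun t _ => by
        have := hZ' _ (hrange _ (hy t) (hmax t))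
        exact rpow_tangent_le hp hpq (hg t) (hy t) this.1 this.2) hhint htop
    have h2 := neg_intervalIntegral_comp_le_integral_Ioi (t₀ := τ) (h := fun t => -hb t)
      (s := fun u => -(p * (Z (u ^ (q - p)) * u) ^ (p - 1))) hsc.neg
      (hasDerivAt_bubble hp hpq) (fun t ht => by
        have hmem : bubbleRatio p q t ∈ Icc 0 a :=
          ⟨(bubbleRatio_pos p q t).le, hτ ▸ bubbleRatio_antitone hp hpq ht⟩
        have e : Z (bubble p q t ^ (q - p)) = bubbleRatio p q t := by
          rw [← bubbleRatio_rpow_mul hp hpq]; exact hZ _ hmem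
        have := rpow_tangent_eq hp hpq (bubble_pos p q t).le (bubbleRatio_pos p q t).le
          (bubbleRatio_rpow_mul hp hpq t)
        rw [e, neg_mul, this]) hhbint.neg (tendsto_bubble_atTop hp hpq)
    rw [intervalIntegral.integral_neg, integral_neg, ← hM] at h2
    linarith
  have e1 : (∫ t, (bubbleRatio p q t * bubble p q t) ^ p) - (p - 1) * ∫ t, bubble p q t ^ q =
      ∫ t, hb t := by
    rw [integral_sub (integrable_bubbleRatio_mul_bubble_rpow_p hp hpq)
      ((integrable_bubble_rpow_q hp hpq).const_mul _), integral_const_mul]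
  have e2 : (∫ t, g t ^ p) - (p - 1) * ∫ t, y t ^ q = ∫ t, h t := by
    rw [integral_sub hgp (hyq.const_mul _), integral_const_mul]
  rw [e1, e2, ← intervalIntegral.integral_Iic_add_Ioi hhbint.integrableOn hhbint.integrableOn
      (b := τ),
    ← intervalIntegral.integral_Iic_add_Ioi hhint.integrableOn hhint.integrableOn (b := t₀)]
  exact add_le_add hleft hright

/-- Sharp inequality for solutions of `y' + (1 - 1 / p) y = g`, normalized by the bubble. -/
lemma integral_rpow_le_of_hasDerivAt (hp : 1 < p) (hpq : p < q) {y g : ℝ → ℝ}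
    (hder : ∀ t, HasDerivAt y (g t - (1 - 1 / p) * y t) t) (hg : ∀ t, 0 ≤ g t)
    (hy : ∀ t, 0 ≤ y t) (hbot : Tendsto y atBot (𝓝 0)) (htop : Tendsto y atTop (𝓝 0))
    (hgp : Integrable fun t => g t ^ p) (hyq : Integrable fun t => y t ^ q) :
    (∫ t, y t ^ q) / ∫ t, bubble p q t ^ q ≤
      ((∫ t, g t ^ p) / ∫ t, (bubbleRatio p q t * bubble p q t) ^ p) ^ (q / p) := by
  have hr := div_sub_one_pos hp hpq
  have hJ := integral_bubble_rpow_q_pos hp hpq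
  have hG := integral_bubbleRatio_mul_bubble_rpow_p hp hpq
  rw [hG]
  set Jb := ∫ t, bubble p q t ^ q with hJb
  have hcont : Continuous y := continuous_iff_continuousAt.2 fun t => (hder t).continuousAt
  have hJ0 : 0 ≤ ∫ t, y t ^ q := integral_nonneg fun t => Real.rpow_nonneg (hy t) _
  have hG0 : 0 ≤ ∫ t, g t ^ p := integral_nonneg fun t => Real.rpow_nonneg (hg t) _
  have hk : 0 < (p - 1) * (q / p) := mul_pos (by linarith) (by linarith)
  by_cases hzero : ∀ t, y t = 0
  · have : ∫ t, y t ^ q = 0 := by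
      simp [hzero, Real.zero_rpow (by linarith : q ≠ 0)]
    rw [this]
    rw [zero_div]
    positivity
  push Not at hzero
  obtain ⟨t₁, ht₁⟩ := hzero
  have ht₁ : 0 < y t₁ := lt_of_le_of_ne (hy t₁) (Ne.symm ht₁)
  obtain ⟨t₀, hmax⟩ := hcont.exists_forall_ge' t₁ (by
    rw [cocompact_eq_atBot_atTop]
    exact eventually_sup.2 ⟨hbot.eventually (ge_mem_nhds ht₁),
      htop.eventually (ge_mem_nhds ht₁)⟩)
  have hM0 : 0 < y t₀ := ht₁.trans_le (hmax t₁)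
  obtain ⟨τ, hτ⟩ := exists_bubbleRatio_eq hp hpq
  set l := bubble p q τ / y t₀ with hl
  have hl0 : 0 < l := div_pos (bubble_pos _ _ _) hM0
  have key := integral_bubble_le_of_max_eq hp hpq (y := fun t => l * y t)
    (g := fun t => l * g t) (t₀ := t₀) (τ := τ)
    (fun t => ((hder t).const_mul l).congr_deriv (by ring))
    (fun t => mul_nonneg hl0.le (hg t)) (fun t => mul_nonneg hl0.le (hy t))
    (by simpa using hbot.const_mul l) (by simpa using htop.const_mul l)
    (by simp_rw [Real.mul_rpow hl0.le (hg _)]; exact hgp.const_mul _)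
    (by simp_rw [Real.mul_rpow hl0.le (hy _)]; exact hyq.const_mul _)
    (fun t => mul_le_mul_of_nonneg_left (hmax t) hl0.le) hτ
    (div_mul_cancel₀ _ hM0.ne')
  simp_rw [Real.mul_rpow hl0.le (hg _), Real.mul_rpow hl0.le (hy _), integral_const_mul] at key
  rw [hG, ← hJb] at key
  set J := ∫ t, y t ^ q
  set G := ∫ t, g t ^ p
  have hp0 : 0 < p := by linarith
  have hq0 : 0 < q := by linarith
  have hA : 0 ≤ l ^ q * J / Jb := by positivity
  have hgm := Real.geom_mean_le_arith_mean2_weighted (w₁ := p / q) (w₂ := 1 - p / q)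
    (p₁ := l ^ q * J / Jb) (p₂ := 1) (by positivity)
    (by rw [sub_nonneg, div_le_one hq0]; exact hpq.le) hA zero_le_one (by ring)
  rw [Real.one_rpow, mul_one] at hgm
  have h1 : p / q * (l ^ q * J / Jb) + (1 - p / q) * 1 ≤
      l ^ p * G / ((p - 1) * (q / p) * Jb) := by
    rw [le_div_iff₀ (by positivity)]
    have e : (p / q * (l ^ q * J / Jb) + (1 - p / q) * 1) * ((p - 1) * (q / p) * Jb) =
        (p - 1) * (q / p) * Jb - (p - 1) * Jb + (p - 1) * (l ^ q * J) := by
      field_simp; ring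
    rw [e]; linarith
  have h2 := Real.rpow_le_rpow (by positivity) (hgm.trans h1) (by positivity : 0 ≤ q / p)
  rw [← Real.rpow_mul hA, div_mul_div_cancel₀ hq0.ne', div_self hp0.ne', Real.rpow_one,
    mul_div_assoc, mul_div_assoc, Real.mul_rpow (by positivity) (by positivity),
    ← Real.rpow_mul hl0.le, mul_div_cancel₀ _ hp0.ne'] at h2
  exact le_of_mul_le_mul_left h2 (by positivity)

end Comparison

/-- Causal convolution with the exponential kernel `exp (-a t)`, `t > 0`. -/
noncomputable def expConv (a : ℝ) (g : ℝ → ℝ≥0∞) (t : ℝ) : ℝ≥0∞ :=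
  ∫⁻ s in Iio t, g s * ENNReal.ofReal (Real.exp (a * (s - t)))

/-- The sharp constant of the exponential convolution inequality, attained by the bubble. -/
noncomputable def bubbleConst (p q : ℝ) : ℝ :=
  (∫ t, bubble p q t ^ q) ^ (1 / q) /
    (∫ t, (bubbleRatio p q t * bubble p q t) ^ p) ^ (1 / p)

section ExpConv

variable {p q : ℝ}

lemma integral_bubbleRatio_mul_bubble_rpow_p_pos (hp : 1 < p) (hpq : p < q) :
    0 < ∫ t, (bubbleRatio p q t * bubble p q t) ^ p := by
  rw [integral_bubbleRatio_mul_bubble_rpow_p hp hpq]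
  have h0 : 0 < p - 1 := by linarith
  have h1 : 0 < q / p := div_pos (by linarith) (by linarith)
  have := integral_bubble_rpow_q_pos hp hpq
  positivity

lemma bubbleConst_pos (hp : 1 < p) (hpq : p < q) : 0 < bubbleConst p q :=
  div_pos (Real.rpow_pos_of_pos (integral_bubble_rpow_q_pos hp hpq) _)
    (Real.rpow_pos_of_pos (integral_bubbleRatio_mul_bubble_rpow_p_pos hp hpq) _)

lemma expConv_ofReal {a : ℝ} {g : ℝ → ℝ} (hg : ∀ t, 0 ≤ g t)
    (hint : Integrable fun s => g s * Real.exp (a * s)) (t : ℝ) :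
    expConv a (fun s => ENNReal.ofReal (g s)) t =
      ENNReal.ofReal (Real.exp (-a * t) * ∫ s in Iic t, g s * Real.exp (a * s)) := by
  unfold expConv
  rw [← integral_const_mul, ofReal_integral_eq_lintegral_ofReal
    (hint.integrableOn.const_mul _)
    (Eventually.of_forall fun s => by have := hg s; positivity),
    setLIntegral_congr Iio_ae_eq_Iic]
  refine lintegral_congr fun s => ?_
  rw [← ENNReal.ofReal_mul (hg s)]
  congr 1
  rw [mul_left_comm, ← Real.exp_add]
  ring_nf

lemma lintegral_expConv_rpow_le_of_hasCompactSupport (hp : 1 < p) (hpq : p < q) {g : ℝ → ℝ}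
    (hgc : Continuous g) (hgs : HasCompactSupport g) (hg : ∀ t, 0 ≤ g t) :
    (∫⁻ t, expConv (1 - 1 / p) (fun s => ENNReal.ofReal (g s)) t ^ q) ^ (1 / q) ≤
      ENNReal.ofReal (bubbleConst p q) * (∫⁻ t, ENNReal.ofReal (g t) ^ p) ^ (1 / p) := by
  have ha := one_sub_one_div_mem hp
  have hp0 : 0 < p := by linarith
  have hq0 : 0 < q := by linarith
  set a := 1 - 1 / p with hadef
  let φ : ℝ → ℝ := fun s => g s * Real.exp (a * s)
  have hφc : Continuous φ := hgc.mul (by fun_prop)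
  have hφs : HasCompactSupport φ := hgs.mul_right
  have hφ0 : ∀ s, 0 ≤ φ s := fun s => mul_nonneg (hg s) (Real.exp_pos _).le
  have hφi : Integrable φ := hφc.integrable_of_hasCompactSupport hφs
  let F : ℝ → ℝ := fun t => ∫ s in Iic t, φ s
  let y : ℝ → ℝ := fun t => Real.exp (-a * t) * F t
  have hF0 : ∀ t, 0 ≤ F t := fun t => setIntegral_nonneg measurableSet_Iic fun s _ => hφ0 s
  have hFle : ∀ t, F t ≤ ∫ s, φ s := fun t =>
    setIntegral_le_integral hφi (Eventually.of_forall hφ0)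
  have hy0 : ∀ t, 0 ≤ y t := fun t => mul_nonneg (Real.exp_pos _).le (hF0 t)
  have hFd : ∀ t, HasDerivAt F (φ t) t := fun t => by
    have h1 : F = fun t => (∫ s in Iic 0, φ s) + ∫ s in (0 : ℝ)..t, φ s := by
      funext t
      have := intervalIntegral.integral_Iic_sub_Iic (a := 0) (b := t) hφi.integrableOn
        hφi.integrableOn
      simp only [F]; linarith
    rw [h1]
    exact (hφc.integral_hasStrictDerivAt 0 t).hasDerivAt.const_add _
  have hder : ∀ t, HasDerivAt y (g t - a * y t) t := fun t => by
    have h1 : HasDerivAt (fun t : ℝ => Real.exp (-a * t)) (Real.exp (-a * t) * (-a)) t := by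
      simpa using ((hasDerivAt_id t).const_mul (-a)).exp
    refine (h1.mul (hFd t)).congr_deriv ?_
    have : Real.exp (-a * t) * φ t = g t := by
      simp only [φ]; rw [mul_left_comm, ← Real.exp_add]; simp
    rw [this]; simp only [y]; ring
  have hyc : Continuous y := continuous_iff_continuousAt.2 fun t => (hder t).continuousAt
  obtain ⟨A, hA⟩ : ∃ A, ∀ t < A, y t = 0 := by
    obtain ⟨A, hA⟩ := hgs.isCompact.bddBelow
    refine ⟨A, fun t ht => ?_⟩
    have : F t = 0 := by
      refine setIntegral_eq_zero_of_forall_eq_zero fun s hs => ?_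
      have : g s = 0 := by
        by_contra h
        exact absurd (hA (subset_tsupport _ h)) (by have := hs.out; linarith)
      simp [φ, this]
    simp [y, this]
  have hbot : Tendsto y atBot (𝓝 0) :=
    tendsto_const_nhds.congr' (by
      filter_upwards [eventually_lt_atBot A] with t ht using (hA t ht).symm)
  have hyle : ∀ t, y t ≤ Real.exp (-a * t) * ∫ s, φ s := fun t =>
    mul_le_mul_of_nonneg_left (hFle t) (Real.exp_pos _).le
  have htop : Tendsto y atTop (𝓝 0) := by
    refine squeeze_zero hy0 hyle ?_
    have : Tendsto (fun t => Real.exp (-a * t)) atTop (𝓝 0) :=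
      Real.tendsto_exp_atBot.comp (tendsto_id.const_mul_atTop_of_neg (by linarith [ha.1]))
    simpa using this.mul_const (∫ s, φ s)
  have hyqc : Continuous fun t => y t ^ q := hyc.rpow_const fun _ => Or.inr hq0.le
  have hφI : 0 ≤ ∫ s, φ s := integral_nonneg hφ0
  have hyq : Integrable fun t => y t ^ q := by
    rw [← integrableOn_univ, ← Iic_union_Ioi (a := A), ← Iio_union_right]
    refine ((IntegrableOn.congr_fun integrableOn_zero (fun t ht => ?_) measurableSet_Iio).union
      ?_).union ?_
    · simp [hA t ht, Real.zero_rpow hq0.ne']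
    · exact integrableOn_singleton (hx := by simp)
    · refine Integrable.mono' ((integrableOn_exp_mul_Ioi (a := -a * q)
        (by nlinarith [mul_pos ha.1 hq0]) A).mul_const ((∫ s, φ s) ^ q))
        hyqc.aestronglyMeasurable (Eventually.of_forall fun t => ?_)
      rw [Real.norm_of_nonneg (Real.rpow_nonneg (hy0 t) _)]
      refine (Real.rpow_le_rpow (hy0 t) (hyle t) hq0.le).trans_eq ?_
      rw [Real.mul_rpow (Real.exp_pos _).le hφI, ← Real.exp_mul]
      ring_nf
  have hgp : Integrable fun t => g t ^ p := by
    refine (hgc.rpow_const fun _ => Or.inr hp0.le).integrable_of_hasCompactSupport ?_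
    exact hgs.comp_left (g := fun x : ℝ => x ^ p) (Real.zero_rpow hp0.ne')
  have key := integral_rpow_le_of_hasDerivAt hp hpq hder hg hy0 hbot htop hgp hyq
  have hJb := integral_bubble_rpow_q_pos hp hpq
  have hGb := integral_bubbleRatio_mul_bubble_rpow_p_pos hp hpq
  have hJ0 : 0 ≤ ∫ t, y t ^ q := integral_nonneg fun t => Real.rpow_nonneg (hy0 t) _
  have hG0 : 0 ≤ ∫ t, g t ^ p := integral_nonneg fun t => Real.rpow_nonneg (hg t) _
  have e1 : ∫⁻ t, expConv a (fun s => ENNReal.ofReal (g s)) t ^ q =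
      ENNReal.ofReal (∫ t, y t ^ q) := by
    rw [ofReal_integral_eq_lintegral_ofReal hyq
      (Eventually.of_forall fun t => Real.rpow_nonneg (hy0 t) _)]
    refine lintegral_congr fun t => ?_
    rw [expConv_ofReal hg hφi, ENNReal.ofReal_rpow_of_nonneg (hy0 t) hq0.le]
  have e2 : ∫⁻ t, ENNReal.ofReal (g t) ^ p = ENNReal.ofReal (∫ t, g t ^ p) := by
    rw [ofReal_integral_eq_lintegral_ofReal hgp
      (Eventually.of_forall fun t => Real.rpow_nonneg (hg t) _)]
    exact lintegral_congr fun t => ENNReal.ofReal_rpow_of_nonneg (hg t) hp0.le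
  rw [e1, e2, ENNReal.ofReal_rpow_of_nonneg hJ0 (by positivity),
    ENNReal.ofReal_rpow_of_nonneg hG0 (by positivity),
    ← ENNReal.ofReal_mul (bubbleConst_pos hp hpq).le]
  refine ENNReal.ofReal_le_ofReal ?_
  have h2 := Real.rpow_le_rpow (by positivity) key (by positivity : 0 ≤ 1 / q)
  rw [← Real.rpow_mul (by positivity), Real.div_rpow hJ0 hJb.le, Real.div_rpow hG0 hGb.le,
    div_mul_div_comm, mul_one, mul_comm p q, ← div_div, div_self hq0.ne',
    div_le_iff₀ (by positivity)] at h2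
  refine h2.trans_eq ?_
  unfold bubbleConst
  ring

end ExpConv

section ExpConvGeneral

lemma measurable_expConv (a : ℝ) {g : ℝ → ℝ≥0∞} (hg : Measurable g) :
    Measurable (expConv a g) := by
  have h : expConv a g = fun t => ENNReal.ofReal (Real.exp (-a * t)) *
      ∫⁻ s in Iio t, g s * ENNReal.ofReal (Real.exp (a * s)) := by
    funext t
    unfold expConv
    rw [← lintegral_const_mul _ (by fun_prop)]
    refine lintegral_congr fun s => ?_
    rw [mul_left_comm, ← ENNReal.ofReal_mul (Real.exp_pos _).le, ← Real.exp_add]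
    ring_nf
  rw [h]
  refine Measurable.mul (by fun_prop) (Monotone.measurable fun s t hst => ?_)
  exact lintegral_mono_set (Iio_subset_Iio hst)

lemma expConv_congr_ae (a : ℝ) {g h : ℝ → ℝ≥0∞} (hgh : g =ᵐ[volume] h) :
    expConv a g = expConv a h := by
  funext t
  refine lintegral_congr_ae (ae_restrict_of_ae ?_)
  filter_upwards [hgh] with s hs
  rw [hs]

lemma expConv_le_add (a : ℝ) {g h k : ℝ → ℝ≥0∞} (hh : Measurable h)
    (hghk : ∀ s, g s ≤ h s + k s) (t : ℝ) :
    expConv a g t ≤ expConv a h t + expConv a k t := by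
  unfold expConv
  rw [← lintegral_add_left (by fun_prop)]
  refine lintegral_mono fun s => ?_
  rw [← add_mul]
  exact mul_le_mul_left (hghk s) _

lemma lintegral_exp_rpow_Iio_lt_top {a q : ℝ} (ha : 0 < a) (hq : 0 < q) (t : ℝ) :
    ∫⁻ s in Iio t, ENNReal.ofReal (Real.exp (a * (s - t))) ^ q < ∞ := by
  have h : ∀ s : ℝ, ENNReal.ofReal (Real.exp (a * (s - t))) ^ q =
      ENNReal.ofReal (Real.exp (-(a * q * t)) * Real.exp (a * q * s)) := fun s => by
    rw [ENNReal.ofReal_rpow_of_pos (Real.exp_pos _), ← Real.exp_mul, ← Real.exp_add]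
    ring_nf
  simp_rw [h]
  refine (hasFiniteIntegral_iff_ofReal (Eventually.of_forall fun s => by positivity)).1 ?_
  exact (((integrableOn_exp_mul_Iic (mul_pos ha hq) t).mono_set
    Iio_subset_Iic_self).const_mul _).2

lemma expConv_le_mul {a p : ℝ} (ha : 0 < a) (hp : 1 < p) (t : ℝ) :
    ∃ N : ℝ≥0∞, N ≠ ∞ ∧ ∀ g : ℝ → ℝ≥0∞, Measurable g →
      expConv a g t ≤ (∫⁻ s, g s ^ p) ^ (1 / p) * N := by
  have hc := Real.HolderConjugate.conjExponent hp
  refine ⟨(∫⁻ s in Iio t, ENNReal.ofReal (Real.exp (a * (s - t))) ^ p.conjExponent) ^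
    (1 / p.conjExponent), (ENNReal.rpow_lt_top_of_nonneg (one_div_nonneg.2 hc.symm.nonneg)
    (lintegral_exp_rpow_Iio_lt_top ha hc.symm.pos t).ne).ne, fun g hg => ?_⟩
  refine (ENNReal.lintegral_mul_le_Lp_mul_Lq (volume.restrict (Iio t)) hc hg.aemeasurable
    (by fun_prop)).trans ?_
  gcongr
  exact Measure.restrict_le_self

/-- The sharp exponential convolution inequality. -/
theorem lintegral_expConv_rpow_le {p q : ℝ} (hp : 1 < p) (hpq : p < q) {g : ℝ → ℝ≥0∞}
    (hg : Measurable g) :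
    (∫⁻ t, expConv (1 - 1 / p) g t ^ q) ^ (1 / q) ≤
      ENNReal.ofReal (bubbleConst p q) * (∫⁻ t, g t ^ p) ^ (1 / p) := by
  have ha := (one_sub_one_div_mem hp).1
  have hp0 : 0 < p := by linarith
  have hq0 : 0 < q := by linarith
  set a := 1 - 1 / p
  have hB : ENNReal.ofReal (bubbleConst p q) ≠ 0 := by simpa using bubbleConst_pos hp hpq
  by_cases hfin : ∫⁻ t, g t ^ p = ∞
  · rw [hfin, ENNReal.top_rpow_of_pos (by positivity), ENNReal.mul_top hB]
    exact le_top
  have hgae : ∀ᵐ t, g t ≠ ∞ := by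
    filter_upwards [ae_lt_top (by fun_prop) hfin] with t ht h
    rw [h, ENNReal.top_rpow_of_pos hp0] at ht
    exact lt_irrefl _ ht
  set g₀ : ℝ → ℝ := fun t => (g t).toReal with hg₀
  have hg₀m : Measurable g₀ := hg.ennreal_toReal
  have hg₀e : g =ᵐ[volume] fun t => ENNReal.ofReal (g₀ t) := by
    filter_upwards [hgae] with t ht
    exact (ENNReal.ofReal_toReal ht).symm
  have hpE0 : ENNReal.ofReal p ≠ 0 := by simpa using hp0
  have hnorm : ∀ h : ℝ → ℝ, eLpNorm h (ENNReal.ofReal p) volume =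
      (∫⁻ t, ENNReal.ofReal |h t| ^ p) ^ (1 / p) := fun h => by
    rw [eLpNorm_eq_lintegral_rpow_enorm_toReal hpE0 ENNReal.ofReal_ne_top,
      ENNReal.toReal_ofReal hp0.le]
    simp_rw [Real.enorm_eq_ofReal_abs]
  have hgnorm : eLpNorm g₀ (ENNReal.ofReal p) volume = (∫⁻ t, g t ^ p) ^ (1 / p) := by
    rw [hnorm]
    congr 1
    refine lintegral_congr_ae ?_
    filter_upwards [hg₀e] with t ht
    rw [ht, abs_of_nonneg ENNReal.toReal_nonneg]
  have hmem : MemLp g₀ (ENNReal.ofReal p) volume := by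
    refine ⟨hg₀m.aestronglyMeasurable, ?_⟩
    rw [hgnorm]
    exact ENNReal.rpow_lt_top_of_nonneg (by positivity) hfin
  set ε : ℕ → ℝ≥0∞ := fun k => ((k : ℝ≥0∞) + 1)⁻¹
  have hε0 : ∀ k, ε k ≠ 0 := fun k => by simp [ε]
  have hεt : Tendsto ε atTop (𝓝 0) := by
    have := (tendsto_add_atTop_iff_nat 1).2 ENNReal.tendsto_inv_nat_nhds_zero
    simpa [ε] using this
  choose h hhs hhe hhc hhm using fun k =>
    hmem.exists_hasCompactSupport_eLpNorm_sub_le ENNReal.ofReal_ne_top (hε0 k)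
  let u : ℕ → ℝ → ℝ≥0∞ := fun k => expConv a fun s => ENNReal.ofReal |h k s|
  have hum : ∀ k, Measurable (u k) := fun k =>
    measurable_expConv a (by have := (hhc k).measurable; fun_prop)
  have hu_le : ∀ k, ∫⁻ t, u k t ^ q ≤
      (ENNReal.ofReal (bubbleConst p q) * ((∫⁻ t, g t ^ p) ^ (1 / p) + ε k)) ^ q := fun k => by
    have h1 := lintegral_expConv_rpow_le_of_hasCompactSupport hp hpq (hhc k).abs
      ((hhs k).comp_left (g := fun x : ℝ => |x|) abs_zero) (fun t => abs_nonneg _)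
    have h2 : eLpNorm (h k) (ENNReal.ofReal p) volume ≤ (∫⁻ t, g t ^ p) ^ (1 / p) + ε k := by
      have e : h k = g₀ - (g₀ - h k) := by simp
      rw [e, ← hgnorm]
      refine (eLpNorm_sub_le hg₀m.aestronglyMeasurable
        (hg₀m.sub (hhc k).measurable).aestronglyMeasurable ?_).trans ?_
      · rw [← ENNReal.ofReal_one]; exact ENNReal.ofReal_le_ofReal hp.le
      · gcongr; exact hhe k
    rw [hnorm] at h2
    have h3 := h1.trans (mul_le_mul_right h2 _)
    rwa [one_div q, ENNReal.rpow_inv_le_iff hq0] at h3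
  have hlim : ∀ t, expConv a g t ^ q ≤ liminf (fun k => u k t ^ q) atTop := fun t => by
    obtain ⟨N, hN, hNle⟩ := expConv_le_mul ha hp t
    have h1 : ∀ k, expConv a g t - ε k * N ≤ u k t := fun k => by
      rw [tsub_le_iff_right, expConv_congr_ae a hg₀e]
      refine (expConv_le_add a (h := fun s => ENNReal.ofReal |h k s|)
        (k := fun s => ENNReal.ofReal |(g₀ - h k) s|)
        (by have := (hhc k).measurable; fun_prop) (fun s => ?_) t).trans ?_
      · rw [← ENNReal.ofReal_add (abs_nonneg _) (abs_nonneg _)]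
        refine ENNReal.ofReal_le_ofReal ?_
        have := le_abs_self (g₀ s - h k s)
        have := le_abs_self (h k s)
        simp only [Pi.sub_apply]
        linarith
      · refine add_le_add_right ((hNle _ ?_).trans ?_) _
        · have := (hg₀m.sub (hhc k).measurable); fun_prop
        · rw [← hnorm]; gcongr; exact hhe k
    have h2 : Tendsto (fun k => (expConv a g t - ε k * N) ^ q) atTop (𝓝 (expConv a g t ^ q)) := by
      have h3 : Tendsto (fun k => ε k * N) atTop (𝓝 0) := by
        simpa using ENNReal.Tendsto.mul_const hεt (Or.inr hN)
      have h4 : Tendsto (fun k => expConv a g t - ε k * N) atTop (𝓝 (expConv a g t)) := by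
        simpa using ENNReal.Tendsto.sub (tendsto_const_nhds (x := expConv a g t)) h3 (by simp)
      exact (ENNReal.continuous_rpow_const.tendsto _).comp h4
    rw [← h2.liminf_eq]
    exact liminf_le_liminf (Eventually.of_forall fun k => by gcongr; exact h1 k)
  rw [one_div q, ENNReal.rpow_inv_le_iff hq0]
  calc ∫⁻ t, expConv a g t ^ q ≤ ∫⁻ t, liminf (fun k => u k t ^ q) atTop := lintegral_mono hlim
    _ ≤ liminf (fun k => ∫⁻ t, u k t ^ q) atTop :=
      lintegral_liminf_le fun k => by have := hum k; fun_prop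
    _ ≤ liminf (fun k => (ENNReal.ofReal (bubbleConst p q) *
          ((∫⁻ t, g t ^ p) ^ (1 / p) + ε k)) ^ q) atTop :=
      liminf_le_liminf (Eventually.of_forall hu_le)
    _ = (ENNReal.ofReal (bubbleConst p q) * (∫⁻ t, g t ^ p) ^ (1 / p)) ^ q := by
      refine Tendsto.liminf_eq ((ENNReal.continuous_rpow_const.tendsto _).comp ?_)
      refine ENNReal.Tendsto.const_mul ?_ (Or.inr ENNReal.ofReal_ne_top)
      simpa using (tendsto_const_nhds (x := (∫⁻ t, g t ^ p) ^ (1 / p))).add hεt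

end ExpConvGeneral

section PolarLog

/-- Integration in polar coordinates for nonnegative functions. -/
lemma lintegral_eq_lintegral_Ioi_toSphere {E : Type*} [NormedAddCommGroup E] [NormedSpace ℝ E]
    [MeasurableSpace E] [BorelSpace E] [FiniteDimensional ℝ E] [Nontrivial E] (μ : Measure E)
    [μ.IsAddHaarMeasure] {F : E → ℝ≥0∞} (hF : Measurable F) :
    ∫⁻ x, F x ∂μ = ∫⁻ r in Ioi (0 : ℝ), ENNReal.ofReal (r ^ (Module.finrank ℝ E - 1)) *
      ∫⁻ ω : Metric.sphere (0 : E) 1, F (r • (ω : E)) ∂μ.toSphere := by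
  have hG : Measurable fun z : Metric.sphere (0 : E) 1 × Ioi (0 : ℝ) =>
      F ((z.2 : ℝ) • (z.1 : E)) := by fun_prop
  have hG' : Measurable fun z : ℝ × Metric.sphere (0 : E) 1 => F (z.1 • (z.2 : E)) := by fun_prop
  have hinner : Measurable fun r : ℝ =>
      ∫⁻ ω : Metric.sphere (0 : E) 1, F (r • (ω : E)) ∂μ.toSphere :=
    hG'.lintegral_prod_right'
  calc ∫⁻ x, F x ∂μ = ∫⁻ x in ({0}ᶜ : Set E), F x ∂μ := by
        rw [restrict_compl_singleton]
    _ = ∫⁻ x : ({0}ᶜ : Set E), F x ∂(μ.comap (↑)) :=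
        (lintegral_subtype_comap (measurableSet_singleton _).compl F).symm
    _ = ∫⁻ z, F ((z.2 : ℝ) • (z.1 : E))
          ∂(μ.toSphere.prod (Measure.volumeIoiPow (Module.finrank ℝ E - 1))) := by
        rw [← μ.measurePreserving_homeomorphUnitSphereProd.lintegral_comp hG]
        refine lintegral_congr fun x => ?_
        congr 1
        have hx : ‖(x : E)‖ ≠ 0 := norm_ne_zero_iff.2 x.2
        simp [smul_smul, hx]
    _ = ∫⁻ r : Ioi (0 : ℝ), ∫⁻ ω : Metric.sphere (0 : E) 1, F ((r : ℝ) • (ω : E)) ∂μ.toSphere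
          ∂(Measure.volumeIoiPow (Module.finrank ℝ E - 1)) :=
        lintegral_prod_symm' _ hG
    _ = _ := by
        have hinner' : Measurable fun r : Ioi (0 : ℝ) =>
            ∫⁻ ω : Metric.sphere (0 : E) 1, F ((r : ℝ) • (ω : E)) ∂μ.toSphere :=
          hinner.comp measurable_subtype_coe
        rw [Measure.volumeIoiPow, lintegral_withDensity_eq_lintegral_mul _ (by fun_prop) hinner',
          ← lintegral_subtype_comap measurableSet_Ioi]
        rfl

lemma lintegral_Ioi_eq_lintegral_exp {c : ℝ} (hc : 0 < c) (G : ℝ → ℝ≥0∞) :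
    ∫⁻ r in Ioi (0 : ℝ), G r =
      ∫⁻ s, ENNReal.ofReal (c * Real.exp (c * s)) * G (Real.exp (c * s)) := by
  have himg : (fun s : ℝ => Real.exp (c * s)) '' univ = Ioi 0 := by
    ext r
    simp only [image_univ, mem_range, mem_Ioi]
    refine ⟨by rintro ⟨s, rfl⟩; positivity, fun hr => ⟨Real.log r / c, ?_⟩⟩
    rw [mul_div_cancel₀ _ hc.ne', Real.exp_log hr]
  have hd : ∀ s ∈ (univ : Set ℝ), HasDerivWithinAt (fun s : ℝ => Real.exp (c * s))
      (c * Real.exp (c * s)) univ s := fun s _ => by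
    have := (((hasDerivAt_id s).const_mul c).exp).hasDerivWithinAt (s := univ)
    simpa [mul_comm] using this
  have hinj : InjOn (fun s : ℝ => Real.exp (c * s)) univ := fun s _ t _ h =>
    mul_left_cancel₀ hc.ne' (Real.exp_injective h)
  rw [← himg, lintegral_image_eq_lintegral_abs_deriv_mul MeasurableSet.univ hd hinj,
    Measure.restrict_univ]
  refine lintegral_congr fun s => ?_
  rw [abs_of_pos (by positivity)]

lemma lintegral_eq_lintegral_exp_toSphere {n : ℕ} (hn : 1 ≤ n) {c : ℝ} (hc : 0 < c)
    {F : EuclideanSpace ℝ (Fin n) → ℝ≥0∞} (hF : Measurable F) :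
    ∫⁻ x, F x = ∫⁻ s : ℝ, ENNReal.ofReal (c * Real.exp (c * n * s)) *
      ∫⁻ ω : Metric.sphere (0 : EuclideanSpace ℝ (Fin n)) 1,
        F (Real.exp (c * s) • (ω : EuclideanSpace ℝ (Fin n)))
          ∂(volume : Measure (EuclideanSpace ℝ (Fin n))).toSphere := by
  have : Nonempty (Fin n) := ⟨⟨0, hn⟩⟩
  rw [lintegral_eq_lintegral_Ioi_toSphere volume hF, lintegral_Ioi_eq_lintegral_exp hc]
  refine lintegral_congr fun s => ?_
  rw [← mul_assoc, ← ENNReal.ofReal_mul (by positivity), finrank_euclideanSpace_fin,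
    ← Real.exp_nat_mul, mul_assoc, ← Real.exp_add, Nat.cast_sub hn]
  ring_nf

lemma volume_unitBall_eq {n : ℕ} (hn : 1 ≤ n) :
    volume (Metric.ball (0 : EuclideanSpace ℝ (Fin n)) 1) = ENNReal.ofReal (omegaN n / n) := by
  have : Nonempty (Fin n) := ⟨⟨0, hn⟩⟩
  have hn0 : (0 : ℝ) < n := by exact_mod_cast hn
  rw [EuclideanSpace.volume_ball, Fintype.card_fin, ENNReal.ofReal_one, one_pow, one_mul]
  congr 1
  rw [omegaN, Real.Gamma_add_one (by positivity), Real.sqrt_eq_rpow, ← Real.rpow_natCast,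
    ← Real.rpow_mul Real.pi_pos.le]
  have := Real.Gamma_pos_of_pos (half_pos hn0)
  field_simp

lemma omegaN_pos {n : ℕ} (hn : 1 ≤ n) : 0 < omegaN n := by
  have hn0 : (0 : ℝ) < n := by exact_mod_cast hn
  have := Real.Gamma_pos_of_pos (half_pos hn0)
  unfold omegaN
  positivity

lemma toSphere_univ_eq {n : ℕ} (hn : 1 ≤ n) :
    (volume : Measure (EuclideanSpace ℝ (Fin n))).toSphere univ = ENNReal.ofReal (omegaN n) := by
  have hn0 : (0 : ℝ) < n := by exact_mod_cast hn
  rw [Measure.toSphere_apply_univ, volume_unitBall_eq hn, finrank_euclideanSpace_fin,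
    ← ENNReal.ofReal_natCast, ← ENNReal.ofReal_mul hn0.le, mul_div_cancel₀ _ hn0.ne']

lemma volume_ball_exp {n : ℕ} (hn : 1 ≤ n) (x : ℝ) :
    volume (Metric.ball (0 : EuclideanSpace ℝ (Fin n)) (Real.exp x)) =
      ENNReal.ofReal (Real.exp (n * x)) * ENNReal.ofReal (omegaN n / n) := by
  rw [Measure.addHaar_ball_of_pos _ _ (Real.exp_pos x), volume_unitBall_eq hn,
    finrank_euclideanSpace_fin, ← Real.exp_nat_mul]

end PolarLog

section HardyLog

variable {n : ℕ}

/-- The integral of `f` over the sphere of radius `exp s`, not weighted by the radius. -/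
noncomputable def sphereIntegral (n : ℕ) (f : EuclideanSpace ℝ (Fin n) → ℝ≥0∞) (s : ℝ) : ℝ≥0∞ :=
  ∫⁻ ω : Metric.sphere (0 : EuclideanSpace ℝ (Fin n)) 1,
    f (Real.exp s • (ω : EuclideanSpace ℝ (Fin n)))
      ∂(volume : Measure (EuclideanSpace ℝ (Fin n))).toSphere

lemma measurable_sphereIntegral {f : EuclideanSpace ℝ (Fin n) → ℝ≥0∞} (hf : Measurable f) :
    Measurable (sphereIntegral n f) := by
  have h : Measurable fun z : ℝ × Metric.sphere (0 : EuclideanSpace ℝ (Fin n)) 1 =>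
      f (Real.exp z.1 • (z.2 : EuclideanSpace ℝ (Fin n))) := by fun_prop
  exact h.lintegral_prod_right'

lemma norm_exp_smul (s : ℝ) (ω : Metric.sphere (0 : EuclideanSpace ℝ (Fin n)) 1) :
    ‖Real.exp s • (ω : EuclideanSpace ℝ (Fin n))‖ = Real.exp s := by
  rw [norm_smul, norm_eq_of_mem_sphere, mul_one, Real.norm_of_nonneg (Real.exp_pos _).le]

lemma sphereIntegral_of_radial (hn : 1 ≤ n) {f : EuclideanSpace ℝ (Fin n) → ℝ≥0∞}
    {φ : ℝ → ℝ≥0∞} (h : ∀ x, f x = φ ‖x‖) (s : ℝ) :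
    sphereIntegral n f s = φ (Real.exp s) * ENNReal.ofReal (omegaN n) := by
  unfold sphereIntegral
  simp_rw [h, norm_exp_smul]
  rw [lintegral_const, toSphere_univ_eq hn]

lemma lintegral_eq_lintegral_sphereIntegral (hn : 1 ≤ n) {c : ℝ} (hc : 0 < c)
    {f : EuclideanSpace ℝ (Fin n) → ℝ≥0∞} (hf : Measurable f) :
    ∫⁻ x, f x = ∫⁻ s : ℝ, ENNReal.ofReal (c * Real.exp (c * n * s)) *
      sphereIntegral n f (c * s) :=
  lintegral_eq_lintegral_exp_toSphere hn hc hf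

lemma sphereIntegral_mul_radial {f : EuclideanSpace ℝ (Fin n) → ℝ≥0∞} (hf : Measurable f)
    (φ : ℝ → ℝ≥0∞) (s : ℝ) :
    sphereIntegral n (fun x => f x * φ ‖x‖) s = sphereIntegral n f s * φ (Real.exp s) := by
  unfold sphereIntegral
  simp_rw [norm_exp_smul]
  rw [lintegral_mul_const _ (by fun_prop)]

/-- Hölder's inequality on the sphere. -/
lemma sphereIntegral_rpow_le (hn : 1 ≤ n) {p : ℝ} (hp : 1 < p)
    {f : EuclideanSpace ℝ (Fin n) → ℝ≥0∞} (hf : Measurable f) (s : ℝ) :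
    sphereIntegral n f s ^ p ≤
      sphereIntegral n (fun x => f x ^ p) s * ENNReal.ofReal (omegaN n) ^ (p - 1) := by
  have hc := Real.HolderConjugate.conjExponent hp
  have hp0 : 0 < p := by linarith
  unfold sphereIntegral
  have h := ENNReal.lintegral_mul_le_Lp_mul_Lq
    (volume : Measure (EuclideanSpace ℝ (Fin n))).toSphere hc
    (f := fun ω => f (Real.exp s • (ω : EuclideanSpace ℝ (Fin n)))) (g := fun _ => 1)
    (by fun_prop) (by fun_prop)
  simp only [Pi.mul_apply, mul_one, ENNReal.one_rpow, lintegral_const, one_mul,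
    toSphere_univ_eq hn] at h
  refine (ENNReal.rpow_le_rpow h hp0.le).trans_eq ?_
  rw [ENNReal.mul_rpow_of_nonneg _ _ hp0.le, ← ENNReal.rpow_mul, ← ENNReal.rpow_mul,
    one_div_mul_cancel hp0.ne', ENNReal.rpow_one]
  congr 2
  rw [Real.conjExponent]
  field_simp

/-- The profile of `f` in logarithmic coordinates with weight `exp (c * b * s)`. -/
noncomputable def logProfile (n : ℕ) (c b : ℝ) (f : EuclideanSpace ℝ (Fin n) → ℝ≥0∞) (s : ℝ) :
    ℝ≥0∞ :=
  sphereIntegral n f (c * s) * ENNReal.ofReal (Real.exp (c * b * s))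

lemma measurable_logProfile {c b : ℝ} {f : EuclideanSpace ℝ (Fin n) → ℝ≥0∞} (hf : Measurable f) :
    Measurable (logProfile n c b f) := by
  have := measurable_sphereIntegral hf
  unfold logProfile
  fun_prop

lemma setLIntegral_ball_exp (hn : 1 ≤ n) {c : ℝ} (hc : 0 < c) (b : ℝ)
    {f : EuclideanSpace ℝ (Fin n) → ℝ≥0∞} (hf : Measurable f) (t : ℝ) :
    ∫⁻ y in Metric.ball (0 : EuclideanSpace ℝ (Fin n)) (Real.exp (c * t)), f y =
      ENNReal.ofReal (c * Real.exp (c * (n - b) * t)) *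
        expConv (c * (n - b)) (logProfile n c b f) t := by
  have hgm := measurable_logProfile (c := c) (b := b) hf
  rw [← lintegral_indicator Metric.isOpen_ball.measurableSet,
    lintegral_eq_lintegral_sphereIntegral hn hc (hf.indicator Metric.isOpen_ball.measurableSet)]
  unfold expConv
  rw [← lintegral_indicator measurableSet_Iio, ← lintegral_const_mul _
    (Measurable.indicator (by fun_prop) measurableSet_Iio)]
  refine lintegral_congr fun s => ?_
  unfold sphereIntegral
  by_cases hst : s < t
  · have hmem : ∀ ω : Metric.sphere (0 : EuclideanSpace ℝ (Fin n)) 1,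
        Real.exp (c * s) • (ω : EuclideanSpace ℝ (Fin n)) ∈
          Metric.ball (0 : EuclideanSpace ℝ (Fin n)) (Real.exp (c * t)) := fun ω => by
      rw [mem_ball_zero_iff, norm_exp_smul, Real.exp_lt_exp]
      exact mul_lt_mul_of_pos_left hst hc
    simp_rw [indicator_of_mem (hmem _), indicator_of_mem (mem_Iio.2 hst), logProfile]
    change _ * sphereIntegral n f (c * s) = _
    rw [mul_comm, mul_assoc (sphereIntegral n f (c * s)),
      mul_left_comm _ (sphereIntegral n f (c * s))]
    congr 1
    rw [← ENNReal.ofReal_mul (by positivity), ← ENNReal.ofReal_mul (by positivity),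
      ← Real.exp_add]
    simp only [mul_assoc c (Real.exp _)]
    rw [← Real.exp_add]
    ring_nf
  · have hmem : ∀ ω : Metric.sphere (0 : EuclideanSpace ℝ (Fin n)) 1,
        Real.exp (c * s) • (ω : EuclideanSpace ℝ (Fin n)) ∉
          Metric.ball (0 : EuclideanSpace ℝ (Fin n)) (Real.exp (c * t)) := fun ω => by
      rw [mem_ball_zero_iff, norm_exp_smul, Real.exp_lt_exp]
      exact fun h => hst (lt_of_mul_lt_mul_left h hc.le)
    simp_rw [indicator_of_notMem (hmem _), indicator_of_notMem (fun h => hst (mem_Iio.1 h))]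
    simp

lemma nHardy_eq_of_norm_eq_exp (hn : 1 ≤ n) {c : ℝ} (hc : 0 < c) (b : ℝ)
    {f : EuclideanSpace ℝ (Fin n) → ℝ≥0∞} (hf : Measurable f) {t : ℝ}
    {x : EuclideanSpace ℝ (Fin n)} (hx : ‖x‖ = Real.exp (c * t)) :
    nHardy n f x = ENNReal.ofReal (n / omegaN n * c * Real.exp (-(c * b * t))) *
      expConv (c * (n - b)) (logProfile n c b f) t := by
  have hn0 : (0 : ℝ) < n := by exact_mod_cast hn
  have hω := omegaN_pos hn
  unfold nHardy
  rw [hx, setLIntegral_ball_exp hn hc b hf, volume_ball_exp hn, ← mul_assoc,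
    ← ENNReal.ofReal_mul (by positivity), ← ENNReal.ofReal_inv_of_pos (by positivity),
    ← ENNReal.ofReal_mul (by positivity)]
  congr 2
  rw [mul_inv, ← Real.exp_neg, inv_div]
  have : Real.exp (-(c * b * t)) =
      Real.exp (-(n * (c * t))) * Real.exp (c * (n - b) * t) := by
    rw [← Real.exp_add]; ring_nf
  rw [this]
  ring

lemma measurable_nHardy (f : EuclideanSpace ℝ (Fin n) → ℝ≥0∞) : Measurable (nHardy n f) := by
  have h1 : Measurable fun r : ℝ =>
      volume (Metric.ball (0 : EuclideanSpace ℝ (Fin n)) r) :=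
    Monotone.measurable fun r s h => measure_mono (Metric.ball_subset_ball h)
  have h2 : Measurable fun r : ℝ =>
      ∫⁻ y in Metric.ball (0 : EuclideanSpace ℝ (Fin n)) r, f y :=
    Monotone.measurable fun r s h => lintegral_mono_set (Metric.ball_subset_ball h)
  exact (h1.comp measurable_norm).inv.mul (h2.comp measurable_norm)

/-- The weighted norm of the Hardy operator in logarithmic coordinates. -/
lemma lintegral_nHardy_rpow_eq (hn : 1 ≤ n) {c b q α : ℝ} (hc : 0 < c) (hq : 0 < q)
    (hb : α + n = b * q) {f : EuclideanSpace ℝ (Fin n) → ℝ≥0∞} (hf : Measurable f) :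
    ∫⁻ x, nHardy n f x ^ q * ENNReal.ofReal (‖x‖ ^ α) =
      ENNReal.ofReal (c * (n / omegaN n * c) ^ q * omegaN n) *
        ∫⁻ t, expConv (c * (n - b)) (logProfile n c b f) t ^ q := by
  have hn0 : (0 : ℝ) < n := by exact_mod_cast hn
  have hω := omegaN_pos hn
  have hm := measurable_nHardy f
  have hE := measurable_expConv (c * (n - b)) (measurable_logProfile (c := c) (b := b) hf)
  rw [lintegral_eq_lintegral_sphereIntegral hn hc (by fun_prop),
    ← lintegral_const_mul _ (by fun_prop)]
  refine lintegral_congr fun t => ?_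
  unfold sphereIntegral
  simp_rw [nHardy_eq_of_norm_eq_exp hn hc b hf (norm_exp_smul (c * t) _), norm_exp_smul]
  rw [lintegral_const, toSphere_univ_eq hn, ENNReal.mul_rpow_of_nonneg _ _ hq.le,
    ENNReal.ofReal_rpow_of_pos (by positivity)]
  have hcomm : ∀ A O P X R : ℝ≥0∞, A * (P * X * R * O) = A * P * R * O * X := by
    intros; ring
  rw [hcomm, ← ENNReal.ofReal_mul (by positivity), ← ENNReal.ofReal_mul (by positivity),
    ← ENNReal.ofReal_mul (by positivity)]
  congr 2
  rw [Real.mul_rpow (by positivity) (Real.exp_pos _).le, ← Real.exp_mul, ← Real.exp_mul]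
  have : Real.exp (c * n * t) * (Real.exp (-(c * b * t) * q) * Real.exp (c * t * α)) = 1 := by
    rw [← Real.exp_add, ← Real.exp_add, Real.exp_eq_one_iff]
    linear_combination c * t * hb
  linear_combination (c * omegaN n * (n / omegaN n * c) ^ q) * this

lemma lintegral_rpow_mul_weight_eq (hn : 1 ≤ n) {c b p γ : ℝ} (hc : 0 < c)
    (hb : γ + n = b * p) {f : EuclideanSpace ℝ (Fin n) → ℝ≥0∞} (hf : Measurable f) :
    ∫⁻ x, f x ^ p * ENNReal.ofReal (‖x‖ ^ γ) =
      ENNReal.ofReal c * ∫⁻ s, ENNReal.ofReal (Real.exp (c * b * s)) ^ p *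
        sphereIntegral n (fun x => f x ^ p) (c * s) := by
  have hS := measurable_sphereIntegral (hf.pow_const p)
  rw [lintegral_eq_lintegral_sphereIntegral hn hc (by fun_prop),
    ← lintegral_const_mul _ (by fun_prop)]
  refine lintegral_congr fun s => ?_
  rw [sphereIntegral_mul_radial (hf.pow_const p) fun r => ENNReal.ofReal (r ^ γ),
    mul_left_comm, mul_comm (sphereIntegral _ _ _), ← ENNReal.ofReal_mul (by positivity),
    ENNReal.ofReal_rpow_of_pos (by positivity), ← mul_assoc, ← ENNReal.ofReal_mul hc.le,
    ← Real.exp_mul, ← Real.exp_mul, mul_assoc, ← Real.exp_add]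
  congr 4
  linear_combination c * s * hb

lemma lintegral_logProfile_rpow_le (hn : 1 ≤ n) {c b p γ : ℝ} (hc : 0 < c) (hp : 1 < p)
    (hb : γ + n = b * p) {f : EuclideanSpace ℝ (Fin n) → ℝ≥0∞} (hf : Measurable f) :
    ENNReal.ofReal c * ∫⁻ s, logProfile n c b f s ^ p ≤
      ENNReal.ofReal (omegaN n) ^ (p - 1) * ∫⁻ x, f x ^ p * ENNReal.ofReal (‖x‖ ^ γ) := by
  have hp0 : 0 < p := by linarith
  have hS := measurable_sphereIntegral (hf.pow_const p)
  rw [lintegral_rpow_mul_weight_eq hn hc hb hf, mul_left_comm,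
    ← lintegral_const_mul (ENNReal.ofReal (omegaN n) ^ (p - 1)) (by fun_prop)]
  gcongr with s
  rw [logProfile, ENNReal.mul_rpow_of_nonneg _ _ hp0.le, mul_left_comm, mul_comm]
  refine mul_le_mul_right ((sphereIntegral_rpow_le hn hp hf _).trans_eq (mul_comm _ _)) _

end HardyLog

section Constant

variable {p q : ℝ}

lemma integrable_bubbleRatio_mul_bubble_mul_exp (hp : 1 < p) (hpq : p < q) :
    Integrable fun t => bubbleRatio p q t * bubble p q t * Real.exp ((1 - 1 / p) * t) := by
  have hr := div_sub_one_pos hp hpq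
  have h : ∀ t, bubbleRatio p q t * bubble p q t * Real.exp ((1 - 1 / p) * t) =
      Real.exp (1 * t) * (1 + Real.exp ((q / p - 1) * t)) ^ (-(1 / (q / p - 1) + 1)) := fun t => by
    have hE := one_add_exp_pos ((q / p - 1) * t)
    rw [bubble_eq, bubbleRatio, neg_add, Real.rpow_add hE, Real.rpow_neg_one]
    have : Real.exp (1 * t) = Real.exp (1 / p * t) * Real.exp ((1 - 1 / p) * t) := by
      rw [← Real.exp_add]; ring_nf
    rw [this]
    ring
  simp_rw [h]
  refine integrable_exp_mul_one_add_exp_rpow one_pos (by positivity) ?_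
  rw [mul_add, mul_one_div_cancel hr.ne']
  linarith

lemma expConv_bubbleRatio_mul_bubble (hp : 1 < p) (hpq : p < q) (t : ℝ) :
    expConv (1 - 1 / p) (fun s => ENNReal.ofReal (bubbleRatio p q s * bubble p q s)) t =
      ENNReal.ofReal (bubble p q t) := by
  have hint := integrable_bubbleRatio_mul_bubble_mul_exp hp hpq
  have ha := (one_sub_one_div_mem hp).1
  rw [expConv_ofReal (fun t => (mul_pos (bubbleRatio_pos p q t) (bubble_pos p q t)).le) hint]
  set a := 1 - 1 / p with hadef
  have hd : ∀ s ∈ Iic t, HasDerivAt (fun s => bubble p q s * Real.exp (a * s))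
      (bubbleRatio p q s * bubble p q s * Real.exp (a * s)) s := fun s _ => by
    have h1 : HasDerivAt (fun s : ℝ => Real.exp (a * s)) (Real.exp (a * s) * a) s := by
      simpa using ((hasDerivAt_id s).const_mul a).exp
    refine ((hasDerivAt_bubble hp hpq s).mul h1).congr_deriv ?_
    ring
  have hbot : Tendsto (fun s => bubble p q s * Real.exp (a * s)) atBot (𝓝 0) := by
    simpa using (tendsto_bubble_atBot hp hpq).mul
      (Real.tendsto_exp_atBot.comp (tendsto_id.const_mul_atBot ha))
  rw [integral_Iic_of_hasDerivAt_of_tendsto' hd hint.integrableOn hbot, sub_zero, mul_left_comm,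
    ← Real.exp_add]
  simp

lemma betaFn_eq_integral_exp {r : ℝ} (hr : 0 < r) (z w : ℝ) :
    betaFn z w = r * ∫ t, Real.exp (r * z * t) * (1 + Real.exp (r * t)) ^ (-(z + w)) := by
  let f : ℝ → ℝ := fun t => Real.exp (r * t) / (1 + Real.exp (r * t))
  have hd : ∀ t ∈ (univ : Set ℝ),
      HasDerivWithinAt f (r * Real.exp (r * t) / (1 + Real.exp (r * t)) ^ 2) univ t := fun t _ => by
    have h1 : HasDerivAt (fun t : ℝ => Real.exp (r * t)) (Real.exp (r * t) * r) t := by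
      simpa using ((hasDerivAt_id t).const_mul r).exp
    refine (((h1.div (h1.const_add 1) (one_add_exp_pos _).ne').congr_deriv ?_)).hasDerivWithinAt
    ring
  have hinj : InjOn f univ := fun s _ t _ h => by
    have hs := one_add_exp_pos (r * s)
    have ht := one_add_exp_pos (r * t)
    simp only [f] at h
    rw [div_eq_div_iff hs.ne' ht.ne'] at h
    exact mul_left_cancel₀ hr.ne' (Real.exp_injective (by linarith))
  have himg : f '' univ = Ioo 0 1 := by
    ext u
    simp only [image_univ, mem_range, mem_Ioo]
    constructor
    · rintro ⟨t, rfl⟩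
      have := Real.exp_pos (r * t)
      exact ⟨by positivity, by simp only [f]; rw [div_lt_one (by positivity)]; linarith⟩
    · rintro ⟨h0, h1⟩
      have h1' : 0 < 1 - u := by linarith
      refine ⟨Real.log (u / (1 - u)) / r, ?_⟩
      simp only [f]
      rw [mul_div_cancel₀ _ hr.ne', Real.exp_log (by positivity)]
      field_simp
      ring
  unfold betaFn
  rw [← himg, integral_image_eq_integral_abs_deriv_smul MeasurableSet.univ hd hinj,
    Measure.restrict_univ, ← integral_const_mul]
  refine integral_congr_ae (Eventually.of_forall fun t => ?_)
  have hE := Real.exp_pos (r * t)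
  have hE1 := one_add_exp_pos (r * t)
  have e1 : 1 - f t = (1 + Real.exp (r * t))⁻¹ := by simp only [f]; field_simp; ring
  have e2 : Real.exp (r * z * t) = Real.exp (r * t) ^ z := by rw [← Real.exp_mul]; ring_nf
  simp only [smul_eq_mul]
  rw [abs_of_pos (by positivity), e1, e2]
  simp only [f]
  rw [Real.div_rpow hE.le hE1.le, Real.inv_rpow hE1.le, Real.rpow_neg hE1.le, Real.rpow_add hE1,
    Real.rpow_sub_one hE.ne', Real.rpow_sub_one hE1.ne', Real.rpow_sub_one hE1.ne']
  field_simp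

lemma integral_bubbleRatio_mul_bubble_rpow_p_eq_betaFn (hp : 1 < p) (hpq : p < q) :
    ∫ t, (bubbleRatio p q t * bubble p q t) ^ p =
      (p / (q - p)) * betaFn (p / (q - p)) (p * q / ((q / (q - 1)) * (q - p))) := by
  have hr := div_sub_one_pos hp hpq
  have hqp : q - p ≠ 0 := by linarith
  have hp0 : p ≠ 0 := by linarith
  have hq0 : q ≠ 0 := by linarith
  have hq1 : q - 1 ≠ 0 := by linarith
  rw [betaFn_eq_integral_exp hr, ← mul_assoc]
  have e1 : p / (q - p) * (q / p - 1) = 1 := by field_simp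
  have e2 : (q / p - 1) * (p / (q - p)) = 1 := by rw [mul_comm]; exact e1
  have e3 : p / (q - p) + p * q / ((q / (q - 1)) * (q - p)) = q / (q / p - 1) := by
    have : q / p - 1 = (q - p) / p := by field_simp
    rw [this]; field_simp; ring
  rw [e1, one_mul, e2, e3]
  simp_rw [bubbleRatio_mul_bubble_rpow_p hp hpq]

lemma bubbleConst_eq (hp : 1 < p) (hpq : p < q) :
    bubbleConst p q = ((p / (p - 1)) / q) ^ (1 / q) *
      ((p / (q - p)) *
        betaFn (p / (q - p)) (p * q / ((q / (q - 1)) * (q - p)))) ^ (1 / q - 1 / p) := by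
  have hp0 : 0 < p := by linarith
  have hp1 : 0 < p - 1 := by linarith
  have hq0 : 0 < q := by linarith
  have hG := integral_bubbleRatio_mul_bubble_rpow_p_pos hp hpq
  have hJ := integral_bubble_rpow_q_pos hp hpq
  rw [← integral_bubbleRatio_mul_bubble_rpow_p_eq_betaFn hp hpq, bubbleConst,
    Real.rpow_sub hG, ← mul_div_assoc, ← Real.mul_rpow (by positivity) hG.le]
  congr 2
  rw [integral_bubbleRatio_mul_bubble_rpow_p hp hpq]
  field_simp

lemma nHardy_const_eq {n : ℕ} (hn : 1 ≤ n) {p q γ : ℝ} (hp : 1 < p) (hpq : p < q)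
    (hγ : γ < n * (p - 1)) {c : ℝ} (hc : c = (p - 1) / (n * (p - 1) - γ)) :
    (omegaN n) ^ (1 / q - 1 / p) * (n : ℝ) ^ (1 / p - 1 / q) *
        ((n * (p - 1)) / (n * (p - 1) - γ)) ^ ((1 - 1 / p) + 1 / q) *
        ((p / (p - 1)) / q) ^ (1 / q) *
        ((p / (q - p)) *
          betaFn (p / (q - p)) (p * q / ((q / (q - 1)) * (q - p)))) ^ (1 / q - 1 / p) =
      (c * (n / omegaN n * c) ^ q * omegaN n) ^ (1 / q) *
        (omegaN n ^ (p - 1) / c) ^ (1 / p) * bubbleConst p q := by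
  have hω := omegaN_pos hn
  have hn0 : (0 : ℝ) < n := by exact_mod_cast hn
  have hp0 : 0 < p := by linarith
  have hq0 : 0 < q := by linarith
  have hc0 : 0 < c := by rw [hc]; apply div_pos <;> linarith
  have e : (n * (p - 1)) / (n * (p - 1) - γ) = n * c := by rw [hc, mul_div_assoc]
  rw [mul_assoc _ (((p / (p - 1)) / q) ^ (1 / q)), ← bubbleConst_eq hp hpq, e]
  congr 1
  rw [Real.mul_rpow (by positivity) hω.le, Real.mul_rpow hc0.le (by positivity),
    ← Real.rpow_mul (by positivity), mul_one_div_cancel hq0.ne', Real.rpow_one,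
    Real.div_rpow (by positivity) hc0.le, ← Real.rpow_mul hω.le, Real.mul_rpow hn0.le hc0.le,
    mul_one_div, sub_div]
  rw [div_self hp0.ne', Real.rpow_sub hω, Real.rpow_sub hω, Real.rpow_sub hn0, Real.rpow_add hn0,
    Real.rpow_sub hn0, Real.rpow_add hc0, Real.rpow_sub hc0, Real.rpow_one, Real.rpow_one,
    Real.rpow_one]
  field_simp

end Constant

section Sharp

variable {n : ℕ} {p q γ α : ℝ}

lemma lintegral_nHardy_rpow_le (hn : 1 ≤ n) (hp : 1 < p) (hpq : p < q) {b c : ℝ} (hc : 0 < c)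
    (hα : α + n = b * q) (hγ : γ + n = b * p) (hcb : c * (n - b) = 1 - 1 / p)
    {f : EuclideanSpace ℝ (Fin n) → ℝ≥0∞} (hf : Measurable f) :
    (∫⁻ x, nHardy n f x ^ q * ENNReal.ofReal (‖x‖ ^ α)) ^ (1 / q) ≤
      ENNReal.ofReal ((c * (n / omegaN n * c) ^ q * omegaN n) ^ (1 / q) *
        (omegaN n ^ (p - 1) / c) ^ (1 / p) * bubbleConst p q) *
      (∫⁻ x, f x ^ p * ENNReal.ofReal (‖x‖ ^ γ)) ^ (1 / p) := by
  have hω := omegaN_pos hn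
  have hn0 : (0 : ℝ) < n := by exact_mod_cast hn
  have hp0 : 0 < p := by linarith
  have hq0 : 0 < q := by linarith
  have hB := bubbleConst_pos hp hpq
  have h1 := lintegral_expConv_rpow_le hp hpq (measurable_logProfile (c := c) (b := b) hf)
  have h2 : ∫⁻ s, logProfile n c b f s ^ p ≤ ENNReal.ofReal (omegaN n ^ (p - 1) / c) *
      ∫⁻ x, f x ^ p * ENNReal.ofReal (‖x‖ ^ γ) := by
    have h := lintegral_logProfile_rpow_le hn hc hp hγ hf
    rw [ENNReal.ofReal_rpow_of_pos hω] at h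
    rw [ENNReal.ofReal_div_of_pos hc, ENNReal.mul_comm_div, ← mul_div_assoc,
      ENNReal.le_div_iff_mul_le (Or.inl (by simpa using hc)) (Or.inl ENNReal.ofReal_ne_top),
      mul_comm]
    exact h
  rw [lintegral_nHardy_rpow_eq hn hc hq0 hα hf, hcb, ENNReal.mul_rpow_of_nonneg _ _ (by positivity),
    ENNReal.ofReal_rpow_of_nonneg (by positivity) (by positivity),
    mul_assoc (_ ^ (1 / q) : ℝ), ENNReal.ofReal_mul (by positivity),
    ENNReal.ofReal_mul (by positivity), mul_assoc (ENNReal.ofReal _), mul_assoc (ENNReal.ofReal _)]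
  refine mul_le_mul_right (h1.trans ?_) _
  rw [mul_left_comm]
  refine mul_le_mul_right ((ENNReal.rpow_le_rpow h2 (by positivity)).trans_eq ?_) _
  rw [ENNReal.mul_rpow_of_nonneg _ _ (by positivity),
    ENNReal.ofReal_rpow_of_nonneg (by positivity) (by positivity)]

lemma lintegral_ofReal_bubble_rpow_q (hp : 1 < p) (hpq : p < q) :
    ∫⁻ t, ENNReal.ofReal (bubble p q t) ^ q = ENNReal.ofReal (∫ t, bubble p q t ^ q) := by
  rw [ofReal_integral_eq_lintegral_ofReal (integrable_bubble_rpow_q hp hpq)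
    (Eventually.of_forall fun t => Real.rpow_nonneg (bubble_pos p q t).le _)]
  exact lintegral_congr fun t => ENNReal.ofReal_rpow_of_pos (bubble_pos p q t)

lemma lintegral_ofReal_bubbleRatio_mul_bubble_rpow_p (hp : 1 < p) (hpq : p < q) :
    ∫⁻ t, ENNReal.ofReal (bubbleRatio p q t * bubble p q t) ^ p =
      ENNReal.ofReal (∫ t, (bubbleRatio p q t * bubble p q t) ^ p) := by
  have h0 : ∀ t, 0 < bubbleRatio p q t * bubble p q t := fun t =>
    mul_pos (bubbleRatio_pos p q t) (bubble_pos p q t)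
  rw [ofReal_integral_eq_lintegral_ofReal (integrable_bubbleRatio_mul_bubble_rpow_p hp hpq)
    (Eventually.of_forall fun t => Real.rpow_nonneg (h0 t).le _)]
  exact lintegral_congr fun t => ENNReal.ofReal_rpow_of_pos (h0 t)

/-- The radial extremizer of the weighted Hardy inequality. -/
noncomputable def hardyExtremizer (n : ℕ) (p q b c : ℝ) (x : EuclideanSpace ℝ (Fin n)) : ℝ≥0∞ :=
  ENNReal.ofReal (bubbleRatio p q (Real.log ‖x‖ / c) * bubble p q (Real.log ‖x‖ / c)) *
    ENNReal.ofReal (‖x‖ ^ (-b))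

lemma measurable_hardyExtremizer (hp : 1 < p) (hpq : p < q) (b c : ℝ) :
    Measurable (hardyExtremizer n p q b c) := by
  have h1 := (continuous_bubble hp hpq).measurable
  have h2 := (continuous_bubbleRatio (p := p) (q := q)).measurable
  unfold hardyExtremizer
  fun_prop

lemma le_of_forall_nHardy_le (hn : 1 ≤ n) (hp : 1 < p) (hpq : p < q) {b c : ℝ} (hc : 0 < c)
    (hα : α + n = b * q) (hγ : γ + n = b * p) (hcb : c * (n - b) = 1 - 1 / p) {C : ℝ≥0∞}
    (hC : (∫⁻ x, nHardy n (hardyExtremizer n p q b c) x ^ q * ENNReal.ofReal (‖x‖ ^ α)) ^ (1 / q) ≤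
      C * (∫⁻ x, hardyExtremizer n p q b c x ^ p * ENNReal.ofReal (‖x‖ ^ γ)) ^ (1 / p)) :
    ENNReal.ofReal ((c * (n / omegaN n * c) ^ q * omegaN n) ^ (1 / q) *
        (omegaN n ^ (p - 1) / c) ^ (1 / p) * bubbleConst p q) ≤ C := by
  have hω := omegaN_pos hn
  have hn0 : (0 : ℝ) < n := by exact_mod_cast hn
  have hp0 : 0 < p := by linarith
  have hq0 : 0 < q := by linarith
  have hf : Measurable (hardyExtremizer n p q b c) := measurable_hardyExtremizer hp hpq b c
  have hJ := integral_bubble_rpow_q_pos hp hpq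
  have hG := integral_bubbleRatio_mul_bubble_rpow_p_pos hp hpq
  have hlJ := lintegral_ofReal_bubble_rpow_q hp hpq
  have hlG := lintegral_ofReal_bubbleRatio_mul_bubble_rpow_p hp hpq
  have hbm := (continuous_bubble hp hpq).measurable
  have hrm := (continuous_bubbleRatio (p := p) (q := q)).measurable
  let φ : ℝ → ℝ≥0∞ := fun r =>
    ENNReal.ofReal (bubbleRatio p q (Real.log r / c) * bubble p q (Real.log r / c)) *
      ENNReal.ofReal (r ^ (-b))
  have hφ : ∀ s, ENNReal.ofReal (Real.exp (c * b * s)) * φ (Real.exp (c * s)) =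
      ENNReal.ofReal (bubbleRatio p q s * bubble p q s) := fun s => by
    simp only [φ]
    rw [Real.log_exp, mul_div_cancel_left₀ _ hc.ne', mul_left_comm,
      ← ENNReal.ofReal_mul (Real.exp_pos _).le, ← Real.exp_mul, ← Real.exp_add]
    have : c * b * s + c * s * -b = 0 := by ring
    rw [this, Real.exp_zero, ENNReal.ofReal_one, mul_one]
  have hprof : logProfile n c b (hardyExtremizer n p q b c) = fun s =>
      ENNReal.ofReal (omegaN n) * ENNReal.ofReal (bubbleRatio p q s * bubble p q s) := by
    funext s
    rw [logProfile, sphereIntegral_of_radial hn (f := hardyExtremizer n p q b c) (φ := φ) fun x => rfl,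
      ← hφ s]
    ring
  have hconv : ∀ t, expConv (1 - 1 / p) (logProfile n c b (hardyExtremizer n p q b c)) t =
      ENNReal.ofReal (omegaN n) * ENNReal.ofReal (bubble p q t) := fun t => by
    rw [hprof, ← expConv_bubbleRatio_mul_bubble hp hpq]
    unfold expConv
    rw [← lintegral_const_mul _ (by fun_prop)]
    simp_rw [mul_assoc]
  have hL : ∫⁻ x, nHardy n (hardyExtremizer n p q b c) x ^ q * ENNReal.ofReal (‖x‖ ^ α) =
      ENNReal.ofReal (c * (n / omegaN n * c) ^ q * omegaN n *
        (omegaN n ^ q * ∫ t, bubble p q t ^ q)) := by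
    rw [lintegral_nHardy_rpow_eq hn hc hq0 hα hf, hcb]
    simp_rw [hconv, ENNReal.mul_rpow_of_nonneg _ _ hq0.le]
    rw [lintegral_const_mul _ (by fun_prop), hlJ, ENNReal.ofReal_rpow_of_pos hω,
      ← ENNReal.ofReal_mul (by positivity), ← ENNReal.ofReal_mul (by positivity)]
  have hR : ∫⁻ x, hardyExtremizer n p q b c x ^ p * ENNReal.ofReal (‖x‖ ^ γ) =
      ENNReal.ofReal (c * (omegaN n * ∫ t, (bubbleRatio p q t * bubble p q t) ^ p)) := by
    rw [lintegral_rpow_mul_weight_eq hn hc hγ hf, ENNReal.ofReal_mul hc.le]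
    congr 1
    rw [ENNReal.ofReal_mul hω.le, ← hlG, ← lintegral_const_mul _ (by fun_prop)]
    refine lintegral_congr fun s => ?_
    rw [sphereIntegral_of_radial hn (f := fun x => hardyExtremizer n p q b c x ^ p)
      (φ := fun r => φ r ^ p) fun x => rfl, ← mul_assoc,
      ← ENNReal.mul_rpow_of_nonneg _ _ hp0.le, hφ, mul_comm]
  rw [hL, hR, ENNReal.ofReal_rpow_of_nonneg (by positivity) (by positivity),
    ENNReal.ofReal_rpow_of_nonneg (by positivity) (by positivity)] at hC
  have hpos : 0 < (c * (omegaN n * ∫ t, (bubbleRatio p q t * bubble p q t) ^ p)) ^ (1 / p) := by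
    positivity
  rw [← ENNReal.div_le_iff (by simpa using hpos) ENNReal.ofReal_ne_top,
    ← ENNReal.ofReal_div_of_pos hpos] at hC
  refine le_of_eq_of_le ?_ hC
  congr 1
  have hA : 0 < c * (n / omegaN n * c) ^ q * omegaN n := by positivity
  generalize c * (n / omegaN n * c) ^ q * omegaN n = A at hA ⊢
  rw [bubbleConst, Real.mul_rpow (x := A) hA.le (by positivity),
    Real.mul_rpow (x := omegaN n ^ q) (by positivity) hJ.le, ← Real.rpow_mul hω.le,
    mul_one_div_cancel hq0.ne', Real.rpow_one, Real.div_rpow (by positivity) hc.le,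
    ← Real.rpow_mul hω.le, mul_one_div, sub_div, div_self hp0.ne', Real.rpow_sub hω, Real.rpow_one,
    Real.mul_rpow hc.le (by positivity), Real.mul_rpow hω.le hG.le]
  field_simp

end Sharp

end Helpers

/-- Sharp weighted bound `‖ℍ f‖_{L^q(ℝⁿ,|x|^α)} ≤ C*_{pq} ‖f‖_{L^p(ℝⁿ,|x|^γ)}`. -/
theorem weighted_nHardy_sharp (n : ℕ) (hn : 1 ≤ n) (p q γ α : ℝ)
    (hp : 1 < p) (hpq : p < q) (hγ : γ < n * (p - 1))
    (hscal : (α + n) / q = (γ + n) / p) :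
    (∀ f : EuclideanSpace ℝ (Fin n) → ℝ≥0∞, Measurable f →
      (∫⁻ x, nHardy n f x ^ q * ENNReal.ofReal (‖x‖ ^ α)) ^ (1 / q)
        ≤ ENNReal.ofReal
            ((omegaN n) ^ (1 / q - 1 / p) * (n : ℝ) ^ (1 / p - 1 / q) *
              ((n * (p - 1)) / (n * (p - 1) - γ)) ^ ((1 - 1 / p) + 1 / q) *
              ((p / (p - 1)) / q) ^ (1 / q) *
              ((p / (q - p)) *
                betaFn (p / (q - p)) (p * q / ((q / (q - 1)) * (q - p)))) ^ (1 / q - 1 / p)) *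
          (∫⁻ x, f x ^ p * ENNReal.ofReal (‖x‖ ^ γ)) ^ (1 / p)) ∧
    (∀ C : ℝ≥0∞,
      (∀ f : EuclideanSpace ℝ (Fin n) → ℝ≥0∞, Measurable f →
        (∫⁻ x, nHardy n f x ^ q * ENNReal.ofReal (‖x‖ ^ α)) ^ (1 / q)
          ≤ C * (∫⁻ x, f x ^ p * ENNReal.ofReal (‖x‖ ^ γ)) ^ (1 / p)) →
      ENNReal.ofReal
          ((omegaN n) ^ (1 / q - 1 / p) * (n : ℝ) ^ (1 / p - 1 / q) *
            ((n * (p - 1)) / (n * (p - 1) - γ)) ^ ((1 - 1 / p) + 1 / q) *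
            ((p / (p - 1)) / q) ^ (1 / q) *
            ((p / (q - p)) *
              betaFn (p / (q - p)) (p * q / ((q / (q - 1)) * (q - p)))) ^ (1 / q - 1 / p)) ≤ C) := by
  have hn0 : (0 : ℝ) < n := by exact_mod_cast hn
  have hp0 : 0 < p := by linarith
  have hq0 : 0 < q := by linarith
  have hd : 0 < n * (p - 1) - γ := by linarith
  have hc : 0 < (p - 1) / (n * (p - 1) - γ) := div_pos (by linarith) hd
  have hα' : α + n = (γ + n) / p * q := by rwa [div_eq_iff hq0.ne'] at hscal
  have hγ' : γ + n = (γ + n) / p * p := (div_mul_cancel₀ _ hp0.ne').symm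
  have hcb : (p - 1) / (n * (p - 1) - γ) * (n - (γ + n) / p) = 1 - 1 / p := by
    rw [div_mul_eq_mul_div, div_eq_iff hd.ne']
    field_simp
    ring
  rw [nHardy_const_eq hn hp hpq hγ rfl]
  exact ⟨fun f hf => lintegral_nHardy_rpow_le hn hp hpq hc hα' hγ' hcb hf,
    fun C hC => le_of_forall_nHardy_le hn hp hpq hc hα' hγ' hcb
      (hC _ (measurable_hardyExtremizer hp hpq _ _))⟩
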